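/- Almost-sure gentle disintegration of the renormalized lattice. Let U be a translationally invariant finite-range lattice gas potential on {0,1}^{ℤ^d} satisfying SM(ℓ0,b,B), fix δ ∈ (0,1/6), and let Γ, γ be the explicit scales Γ_k = exp{(β+1)(3/2)^k}, γ_k = (1/8)exp{β(3/2)^{k+1}} (k ≥ 1), Γ_0 = γ_0 = 0, for a suitable β ≥ 9, with moderation parameters ε ∈ (1/2,1) and a = a_δ(ℓ) = (9d/2)·max(β, ℓ^{(1/3−2δ)d/2}). Then for every sufficiently large ℓ multiple of ℓ0 there exists a measurable set M̄^{(ℓ),℘} with ν^{(ℓ),℘}(M̄^{(ℓ),℘}) = 1 such that: (i) for each n ∈ M̄^{(ℓ),℘} there exists a gentle disintegration 𝒢(n) of the rescaled lattice (℘ℤ)^d with respect to the set of good sites 𝓛_δ^{(℘)}(n), Γ, and γ; (ii) for every t ∈ (℘ℤ)^d and finite X ⊆ (℘ℤ)^d the events {n : t ∈ B_k(n)} and {n : X ∈ 𝒢_k(n)} are measurable with respect to the block variables indexed by sites within ℘-distance θ_k of t, respectively of X. -/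

import Mathlib

namespace Paper

open MeasureTheory
open scoped Classical

noncomputable section

/-- The lattice `ℤ^d`. -/
abbrev ZLat (d : ℕ) := Fin d → ℤ

/-- A lattice gas configuration `η ∈ {0,1}^{ℤ^d}` (`true` = occupied). -/
abbrev GConf (d : ℕ) := ZLat d → Bool

/-- The sup distance on `ℤ^d`. -/
def supD {d : ℕ} (x y : ZLat d) : ℕ := Finset.univ.sup fun i => (x i - y i).natAbs

/-- The sup distance between two finite subsets of the lattice. -/
def fDist {d : ℕ} (A B : Finset (ZLat d)) : ℝ :=
  sInf ((fun p : ZLat d × ZLat d => (supD p.1 p.2 : ℝ)) '' {p | p.1 ∈ A ∧ p.2 ∈ B})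

/-- `f` is a local function with support contained in the finite set `S`. -/
def LocalOn {d : ℕ} (f : GConf d → ℝ) (S : Finset (ZLat d)) : Prop :=
  ∀ σ τ : GConf d, (∀ x ∈ S, σ x = τ x) → f σ = f τ

/-- Sup norm of a real valued function. -/
def supNorm {α : Type*} (f : α → ℝ) : ℝ := ⨆ a, |f a|

/-- The cube `Q_ℓ(i) ⊆ ℤ^d` of side `ℓ` whose lowest corner is the site `ℓ·i`. -/
def cube {d : ℕ} (ℓ : ℕ) (i : ZLat d) : Finset (ZLat d) :=
  Fintype.piFinset fun k => Finset.Ico ((ℓ : ℤ) * i k) ((ℓ : ℤ) * i k + ℓ)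

/-- The Hamiltonian `H_Λ(σ) = ∑_{X ∩ Λ ≠ ∅} Φ_X(σ)` of a potential `Φ`. -/
def hamil {d : ℕ} (Φ : Finset (ZLat d) → GConf d → ℝ) (Λ : Finset (ZLat d))
    (σ : GConf d) : ℝ :=
  ∑' X : Finset (ZLat d), if (X ∩ Λ).Nonempty then Φ X σ else 0

/-- The configuration equal to `σ` inside `Λ` and to the boundary condition `τ`
outside `Λ`. -/
def override {d : ℕ} (Λ : Finset (ZLat d)) (σ : ↥Λ → Bool) (τ : GConf d) : GConf d :=
  fun x => if h : x ∈ Λ then σ ⟨x, h⟩ else τ x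

/-- The finite volume partition function `Z_Λ(τ)`. -/
def partFun {d : ℕ} (Φ : Finset (ZLat d) → GConf d → ℝ) (Λ : Finset (ZLat d))
    (τ : GConf d) : ℝ :=
  ∑ σ : ↥Λ → Bool, Real.exp (hamil Φ Λ (override Λ σ τ))

/-- The expectation of `f` under the finite volume Gibbs measure `μ_Λ^τ`. -/
def gibbsExp {d : ℕ} (Φ : Finset (ZLat d) → GConf d → ℝ) (Λ : Finset (ZLat d))
    (τ : GConf d) (f : GConf d → ℝ) : ℝ :=
  (∑ σ : ↥Λ → Bool, Real.exp (hamil Φ Λ (override Λ σ τ)) * f (override Λ σ τ)) /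
    partFun Φ Λ τ

/-- The finite region `⋃_{i ∈ I} Q_{ℓ0}(i)`: a finite union of cubes of side `ℓ0`
from the partition of `ℤ^d` into such cubes. -/
def cubesRegion {d : ℕ} (ℓ0 : ℕ) (I : Finset (ZLat d)) : Finset (ZLat d) :=
  I.biUnion (cube ℓ0)

/-- Condition SM(ℓ0, b, B) (strong mixing) for the potential `Φ`. -/
def SM {d : ℕ} (Φ : Finset (ZLat d) → GConf d → ℝ) (ℓ0 : ℕ) (b B : ℝ) : Prop :=
  ∀ (I : Finset (ZLat d)) (f g : GConf d → ℝ) (Sf Sg : Finset (ZLat d)),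
    LocalOn f Sf → LocalOn g Sg →
    Sf ⊆ cubesRegion ℓ0 I → Sg ⊆ cubesRegion ℓ0 I →
    (min Sf.card Sg.card : ℝ) * Real.exp (-b * fDist Sf Sg) ≤ 1 →
    ∀ τ : GConf d,
      |gibbsExp Φ (cubesRegion ℓ0 I) τ (fun σ => f σ * g σ) -
          gibbsExp Φ (cubesRegion ℓ0 I) τ f * gibbsExp Φ (cubesRegion ℓ0 I) τ g| ≤
        B * supNorm f * supNorm g * (min Sf.card Sg.card : ℝ) *
          Real.exp (-b * fDist Sf Sg)

/-- A translationally invariant finite-range lattice gas interaction, together with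
an activity `z > 0`; `U_X` vanishes unless `|X| > 1`, is a local function of the
coordinates in `X`, has range `r` and is translationally invariant. -/
structure LatticeGas (d : ℕ) where
  z : ℝ
  zpos : 0 < z
  U : Finset (ZLat d) → GConf d → ℝ
  r : ℕ
  Ulocal : ∀ X, LocalOn (U X) X
  Upair : ∀ X : Finset (ZLat d), X.card ≤ 1 → U X = 0
  Urange : ∀ X : Finset (ZLat d), ∀ x ∈ X, ∀ y ∈ X, r < supD x y → U X = 0
  UtransInv : ∀ (X : Finset (ZLat d)) (i : ZLat d) (σ : GConf d),
    U (X.image (· + i)) σ = U X fun x => σ (x + i)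

/-- The full lattice gas potential determined by the interaction `G.U` and a
(possibly inhomogeneous) family of activities `zf`: single-site terms
`η_x ↦ η_x log (zf x)` and interaction `U_X` for `|X| > 1`. -/
def gasPot {d : ℕ} (G : LatticeGas d) (zf : ZLat d → ℝ) :
    Finset (ZLat d) → GConf d → ℝ :=
  fun X σ =>
    if X.card = 1 then ∑ x ∈ X, (if σ x then Real.log (zf x) else 0) else G.U X σ

/-- The homogeneous lattice gas potential with activity `G.z`. -/
def gasPotH {d : ℕ} (G : LatticeGas d) : Finset (ZLat d) → GConf d → ℝ :=
  gasPot G fun _ => G.z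

/-- `μ` is an infinite volume Gibbs measure for the potential `Φ` (DLR equations). -/
def IsGibbs {d : ℕ} (Φ : Finset (ZLat d) → GConf d → ℝ)
    (μ : Measure (GConf d)) : Prop :=
  ∀ (Λ : Finset (ZLat d)) (f : GConf d → ℝ) (S : Finset (ZLat d)), LocalOn f S →
    (∫ τ, gibbsExp Φ Λ τ f ∂μ) = ∫ σ, f σ ∂μ

/-- The occupation number `η_x ∈ {0,1}` as a real number. -/
def occ {d : ℕ} (x : ZLat d) (η : GConf d) : ℝ := if η x then 1 else 0

/-- The equilibrium density `ρ = μ(η_0)`. -/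
def rho {d : ℕ} (μ : Measure (GConf d)) : ℝ := ∫ η, occ 0 η ∂μ

/-- The compressibility `χ = ∑_x [μ(η_0 η_x) − μ(η_0) μ(η_x)]`. -/
def chi {d : ℕ} (μ : Measure (GConf d)) : ℝ :=
  ∑' x : ZLat d, ((∫ η, occ 0 η * occ x η ∂μ) - rho μ * ∫ η, occ x η ∂μ)

/-- The centered and normalized block variable
`M_i^{(ℓ)}(η) = (∑_{x ∈ Q_ℓ(i)} η_x − ρℓ^d) / √(ℓ^d χ)`. -/
def Mblk {d : ℕ} (μ : Measure (GConf d)) (ℓ : ℕ) (i : ZLat d) (η : GConf d) : ℝ :=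
  ((∑ x ∈ cube ℓ i, occ x η) - rho μ * (ℓ : ℝ) ^ d) / Real.sqrt ((ℓ : ℝ) ^ d * chi μ)

/-- The renormalized measure `ν^{(ℓ)}`: the image of `μ` under the block averaging
map `η ↦ (M_i^{(ℓ)}(η))_i`. -/
def nu {d : ℕ} (μ : Measure (GConf d)) (ℓ : ℕ) : Measure (ZLat d → ℝ) :=
  μ.map fun η => fun i => Mblk μ ℓ i η

/-- The (finite) single-site renormalized configuration space `ℳ_i^{(ℓ)}`. -/
def Mset (d : ℕ) (μ : Measure (GConf d)) (ℓ : ℕ) : Finset ℝ :=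
  (Finset.range (ℓ ^ d + 1)).image fun k =>
    ((k : ℝ) - rho μ * (ℓ : ℝ) ^ d) / Real.sqrt ((ℓ : ℝ) ^ d * chi μ)


/-! Multi-scale (gentle disintegration) machinery on the rescaled lattice
`(℘ℤ)^d ≅ ℤ^d`. -/

/-- The `ℓ¹` distance on the rescaled lattice. -/
def D1 {d : ℕ} (x y : ZLat d) : ℕ := ∑ i, (x i - y i).natAbs

/-- The `ℓ¹` ball of (real) radius `r` around `x`. -/
def ball1 {d : ℕ} (x : ZLat d) (r : ℝ) : Set (ZLat d) := {y | (D1 x y : ℝ) ≤ r}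

/-- `θ_j = ∑_{i=0}^{j} (Γ_i + γ_i)`. -/
def theta (Γ γ : ℕ → ℝ) (j : ℕ) : ℝ := ∑ i ∈ Finset.range (j + 1), (Γ i + γ i)

/-- The explicit scales `Γ_k = exp((β+1)(3/2)^k)` for `k ≥ 1`, `Γ_0 = 0`. -/
def Γex (β : ℝ) (k : ℕ) : ℝ :=
  if k = 0 then 0 else Real.exp ((β + 1) * (3 / 2 : ℝ) ^ k)

/-- The explicit scales `γ_k = (1/8) exp(β (3/2)^{k+1})` for `k ≥ 1`, `γ_0 = 0`. -/
def γex (β : ℝ) (k : ℕ) : ℝ :=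
  if k = 0 then 0 else (1 / 8 : ℝ) * Real.exp (β * (3 / 2 : ℝ) ^ (k + 1))

/-- `x` is a gentle point at level `k ≥ 1` with respect to the set `Bprev`. -/
def gentleOn {d : ℕ} (Γ γ : ℕ → ℝ) (Bprev : Set (ZLat d)) (k : ℕ) (x : ZLat d) :
    Prop :=
  x ∈ Bprev ∧
  (∀ u ∈ ball1 x (Γ k) ∩ Bprev, ∀ v ∈ ball1 x (Γ k) ∩ Bprev, (D1 u v : ℝ) ≤ Γ k) ∧
  (∀ u ∈ ball1 x (Γ k) ∩ Bprev, ∀ v ∈ Bprev \ (ball1 x (Γ k) ∩ Bprev),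
    γ k < (D1 u v : ℝ))

/-- The recursive classification of badness of the field `ω` of bad sites. -/
def badSet {d : ℕ} (Γ γ : ℕ → ℝ) (ω : ZLat d → Bool) : ℕ → Set (ZLat d)
  | 0 => {x | ω x = true}
  | k + 1 => {x | x ∈ badSet Γ γ ω k ∧ ¬ gentleOn Γ γ (badSet Γ γ ω k) (k + 1) x}

/-- The collection of `k`-gentle atoms `𝒢_k(ω)` (for `k ≥ 1`). -/
def atomsAt {d : ℕ} (Γ γ : ℕ → ℝ) (ω : ZLat d → Bool) (k : ℕ) :
    Set (Set (ZLat d)) :=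
  {A | ∃ x : ZLat d, gentleOn Γ γ (badSet Γ γ ω (k - 1)) k x ∧
        A = ball1 x (Γ k) ∩ badSet Γ γ ω (k - 1)}

/-- The smallest coordinate parallelepiped `Env(g)` containing `g`. -/
def env {d : ℕ} (g : Set (ZLat d)) : Set (ZLat d) :=
  {x | ∀ i : Fin d, (∃ u ∈ g, u i ≤ x i) ∧ ∃ v ∈ g, x i ≤ v i}

/-- The residual bad sets of a graded family of atoms. -/
def Bres {d : ℕ} (G0 : Set (ZLat d)) (atoms : ℕ → Set (Set (ZLat d))) :
    ℕ → Set (ZLat d)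
  | 0 => G0ᶜ
  | k + 1 => Bres G0 atoms k \ ⋃ g ∈ atoms (k + 1), g

/-- A gentle disintegration of the (rescaled) lattice `ℤ^d` with respect to `G0` and
the scales `Γ, γ`. -/
structure GentleDisintegration (d : ℕ) (G0 : Set (ZLat d)) (Γ γ : ℕ → ℝ) where
  atoms : ℕ → Set (Set (ZLat d))
  atomFinite : ∀ j, ∀ g ∈ atoms j, g.Finite
  atomNonempty : ∀ j, ∀ g ∈ atoms j, g.Nonempty
  uniqueGrade : ∀ j j' g, g ∈ atoms j → g ∈ atoms j' → j = j'
  pairwiseDisjoint : ∀ j j' g g', g ∈ atoms j → g' ∈ atoms j' → g ≠ g' → Disjoint g g'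
  cover : ∀ x : ZLat d, ∃ j, ∃ g ∈ atoms j, x ∈ g
  grade0 : atoms 0 = {s | ∃ x ∈ G0, s = {x}}
  subsBad : ∀ j, ∀ g ∈ atoms (j + 1), g ⊆ Bres G0 atoms j
  diamBound : ∀ j, 1 ≤ j → ∀ g ∈ atoms j, ∀ u ∈ g, ∀ v ∈ g, (D1 u v : ℝ) ≤ Γ j
  separation : ∀ j, ∀ g ∈ atoms (j + 1), ∀ u ∈ g, ∀ v ∈ Bres G0 atoms j \ g,
    γ (j + 1) < (D1 u v : ℝ)
  horizon : ∀ x : ZLat d,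
    {j : ℕ | 1 ≤ j ∧ ∃ g ∈ atoms j, ∃ y ∈ env g, (supD x y : ℝ) ≤ theta Γ γ j}.Finite

/-- The set of good ℘-sites `𝓛_δ^{(℘)}`: `t` is good iff `|m_i| ≤
ℓ^{(2/3−δ)d}/√(ℓ^d χ)` for every ℓ-block `i` of `Q_℘(t)` (here `℘ = c·ℓ`). -/
def goodSet {d : ℕ} (c : ℕ) (δ : ℝ) (μ : Measure (GConf d)) (ℓ : ℕ)
    (m : ZLat d → ℝ) : Set (ZLat d) :=
  {t | ∀ i ∈ cube c t,
    |m i| ≤ (ℓ : ℝ) ^ ((2 / 3 - δ) * d) / Real.sqrt ((ℓ : ℝ) ^ d * chi μ)}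

/-- The badness indicator field of a block configuration: `ω_t = 1` iff the ℘-site
`t` is bad. -/
def badInd {d : ℕ} (c : ℕ) (δ : ℝ) (μ : Measure (GConf d)) (ℓ : ℕ)
    (m : ZLat d → ℝ) : ZLat d → Bool :=
  fun t => if t ∈ goodSet c δ μ ℓ m then false else true

/-- The σ-algebra on the renormalized configuration space generated by the block
variables `m_i`, `i ∈ S`. -/
def cylR {d : ℕ} (S : Set (ZLat d)) : MeasurableSpace (ZLat d → ℝ) :=
  MeasurableSpace.comap (fun m => fun i : S => m i) inferInstance

/-- The ℓ-blocks of the ℘-sites within ℘-(sup-)distance `θ_k` of the set `S` of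
℘-sites. -/
def blocksNear {d : ℕ} (c : ℕ) (Γ γ : ℕ → ℝ) (k : ℕ) (S : Set (ZLat d)) :
    Set (ZLat d) :=
  {i | ∃ t' : ZLat d, (∃ t ∈ S, (supD t t' : ℝ) ≤ theta Γ γ k) ∧ i ∈ cube c t'}

theorem D1_comm {d : ℕ} (x y : ZLat d) : D1 x y = D1 y x := by
  unfold D1
  refine Finset.sum_congr rfl fun i _ => ?_
  omega

theorem D1_self {d : ℕ} (x : ZLat d) : D1 x x = 0 := by simp [D1]

theorem D1_triangle {d : ℕ} (x y z : ZLat d) : D1 x z ≤ D1 x y + D1 y z := by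
  unfold D1
  rw [← Finset.sum_add_distrib]
  refine Finset.sum_le_sum fun i _ => ?_
  omega

theorem D1_triangle_real {d : ℕ} (x y z : ZLat d) :
    (D1 x z : ℝ) ≤ D1 x y + D1 y z := by
  exact_mod_cast D1_triangle x y z

theorem natAbs_sub_le_supD {d : ℕ} (x y : ZLat d) (i : Fin d) :
    (x i - y i).natAbs ≤ supD x y :=
  Finset.le_sup (f := fun i => (x i - y i).natAbs) (Finset.mem_univ i)

theorem supD_le_iff {d : ℕ} (x y : ZLat d) (n : ℕ) :
    supD x y ≤ n ↔ ∀ i, (x i - y i).natAbs ≤ n := by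
  simp [supD]

theorem supD_le_D1 {d : ℕ} (x y : ZLat d) : supD x y ≤ D1 x y := by
  rw [supD_le_iff]
  intro i
  exact Finset.single_le_sum (f := fun i => (x i - y i).natAbs) (fun _ _ => Nat.zero_le _)
    (Finset.mem_univ i)

theorem supD_triangle {d : ℕ} (x y z : ZLat d) : supD x z ≤ supD x y + supD y z := by
  rw [supD_le_iff]
  intro i
  have h1 := natAbs_sub_le_supD x y i
  have h2 := natAbs_sub_le_supD y z i
  omega

theorem supD_comm {d : ℕ} (x y : ZLat d) : supD x y = supD y x := by
  unfold supD
  congr 1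
  funext i
  omega

theorem supD_self {d : ℕ} (x : ZLat d) : supD x x = 0 := by
  have : supD x x ≤ 0 := (supD_le_iff x x 0).2 fun i => by simp
  omega

/-- The sup-norm ball of radius `n` around `x`. -/
def box {d : ℕ} (x : ZLat d) (n : ℕ) : Finset (ZLat d) :=
  Fintype.piFinset fun k => Finset.Icc (x k - n) (x k + n)

theorem mem_box {d : ℕ} {x y : ZLat d} {n : ℕ} : y ∈ box x n ↔ supD x y ≤ n := by
  rw [supD_le_iff, box, Fintype.mem_piFinset]
  refine forall_congr' fun i => ?_
  rw [Finset.mem_Icc]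
  omega

theorem card_box {d : ℕ} (x : ZLat d) (n : ℕ) : (box x n).card = (2 * n + 1) ^ d := by
  rw [box, Fintype.card_piFinset]
  have : ∀ k, (Finset.Icc (x k - n) (x k + n)).card = 2 * n + 1 := by
    intro k
    rw [Int.card_Icc]
    omega
  simp [this]

theorem finite_ball1 {d : ℕ} (x : ZLat d) (r : ℝ) : (ball1 x r).Finite := by
  refine (box x ⌊r⌋₊).finite_toSet.subset fun y hy => ?_
  have hy' : (D1 x y : ℝ) ≤ r := hy
  rw [Finset.mem_coe, mem_box]
  exact (supD_le_D1 x y).trans (Nat.le_floor hy')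

/-! ### Deterministic properties of the multi-scale classification -/

theorem badSet_succ_subset {d : ℕ} (Γ γ : ℕ → ℝ) (ω : ZLat d → Bool) (k : ℕ) :
    badSet Γ γ ω (k + 1) ⊆ badSet Γ γ ω k := fun _ hx => hx.1

theorem badSet_antitone {d : ℕ} (Γ γ : ℕ → ℝ) (ω : ZLat d → Bool) :
    Antitone (badSet Γ γ ω) :=
  antitone_nat_of_succ_le (badSet_succ_subset Γ γ ω)

/-- A gentle point belongs to its own atom, and every point of this atom is gentle with the
same atom. -/
theorem gentleOn.of_mem {d : ℕ} {Γ γ : ℕ → ℝ} {B : Set (ZLat d)} {k : ℕ}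
    (hΓγ : Γ k ≤ γ k) {x y : ZLat d} (hx : gentleOn Γ γ B k x)
    (hy : y ∈ ball1 x (Γ k) ∩ B) :
    ball1 y (Γ k) ∩ B = ball1 x (Γ k) ∩ B ∧ gentleOn Γ γ B k y := by
  have h : ball1 y (Γ k) ∩ B = ball1 x (Γ k) ∩ B := by
    ext z
    constructor
    · rintro ⟨hz, hzB⟩
      by_contra hcon
      have := hx.2.2 y hy z ⟨hzB, hcon⟩
      have hz' : (D1 y z : ℝ) ≤ Γ k := hz
      linarith
    · intro hz
      exact ⟨hx.2.1 y hy z hz, hz.2⟩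
  refine ⟨h, hy.2, ?_, ?_⟩
  · rw [h]; exact hx.2.1
  · rw [h]; exact hx.2.2

theorem gentleOn.mem_atom {d : ℕ} {Γ γ : ℕ → ℝ} {B : Set (ZLat d)} {k : ℕ} (hΓ : 0 ≤ Γ k)
    {x : ZLat d} (hx : gentleOn Γ γ B k x) : x ∈ ball1 x (Γ k) ∩ B :=
  ⟨by simpa [ball1, D1_self] using hΓ, hx.1⟩

/-- The graded family of atoms of a bad field: singletons of good sites at grade `0`, gentle
atoms at higher grades. -/
def gradedAtoms {d : ℕ} (Γ γ : ℕ → ℝ) (G0 : Set (ZLat d)) (ω : ZLat d → Bool) :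
    ℕ → Set (Set (ZLat d))
  | 0 => {s | ∃ x ∈ G0, s = {x}}
  | k + 1 => atomsAt Γ γ ω (k + 1)

theorem Bres_gradedAtoms {d : ℕ} {Γ γ : ℕ → ℝ} (hΓ : ∀ k, 0 ≤ Γ k) (hΓγ : ∀ k, Γ k ≤ γ k)
    {G0 : Set (ZLat d)} {ω : ZLat d → Bool} (hω : ∀ x, ω x = true ↔ x ∉ G0) (k : ℕ) :
    Bres G0 (gradedAtoms Γ γ G0 ω) k = badSet Γ γ ω k := by
  induction k with
  | zero => ext x; simp [Bres, badSet, hω]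
  | succ k ih =>
    ext x
    simp only [Bres, ih, badSet, Set.mem_sdiff, Set.mem_iUnion, Set.mem_ofPred_eq, not_exists]
    refine and_congr_right fun hx => ⟨fun h hg => ?_, fun h g hg hxg => h ?_⟩
    · exact h _ ⟨x, hg, rfl⟩ (hg.mem_atom (hΓ _))
    · obtain ⟨y, hy, rfl⟩ := hg
      exact (hy.of_mem (hΓγ _) hxg).2

/-- The grade of an atom is determined by any of its points. -/
theorem grade_unique {d : ℕ} {Γ γ : ℕ → ℝ} (hΓγ : ∀ k, Γ k ≤ γ k)
    {G0 : Set (ZLat d)} {ω : ZLat d → Bool} (hω : ∀ x, ω x = true ↔ x ∉ G0)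
    {j j' : ℕ} {g g' : Set (ZLat d)} (hg : g ∈ gradedAtoms Γ γ G0 ω j)
    (hg' : g' ∈ gradedAtoms Γ γ G0 ω j') {x : ZLat d} (hx : x ∈ g) (hx' : x ∈ g') :
    j = j' := by
  have key : ∀ {j : ℕ} {g : Set (ZLat d)}, g ∈ gradedAtoms Γ γ G0 ω j → x ∈ g →
      ∀ i, (x ∈ badSet Γ γ ω i ↔ i < j) := by
    intro j g hg hx i
    cases j with
    | zero =>
      obtain ⟨y, hy, rfl⟩ := hg
      obtain rfl : x = y := hx
      simp only [Nat.not_lt_zero, iff_false]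
      intro hi
      have : x ∈ badSet Γ γ ω 0 := badSet_antitone Γ γ ω (Nat.zero_le i) hi
      exact (hω x).1 this hy
    | succ k =>
      obtain ⟨y, hy, rfl⟩ := hg
      have h1 : x ∈ badSet Γ γ ω k := hx.2
      have h2 : x ∉ badSet Γ γ ω (k + 1) := fun h => h.2 (hy.of_mem (hΓγ _) hx).2
      constructor
      · intro hi
        by_contra hlt
        exact h2 (badSet_antitone Γ γ ω (by omega) hi)
      · intro hi
        exact badSet_antitone Γ γ ω (by omega) h1
  have h := fun i => (key hg hx i).symm.trans (key hg' hx' i)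
  have h1 := h j
  have h2 := h j'
  omega

/-- If every site is close to the `(j-1)`-bad set for finitely many `j` only, then the
multi-scale classification is a gentle disintegration. -/
theorem gentleDisintegration_of_horizon {d : ℕ} {Γ γ : ℕ → ℝ} (hΓ : ∀ k, 0 ≤ Γ k)
    (hΓγ : ∀ k, Γ k ≤ γ k) {G0 : Set (ZLat d)} {ω : ZLat d → Bool}
    (hω : ∀ x, ω x = true ↔ x ∉ G0)
    (hfin : ∀ x : ZLat d, {k : ℕ | ∃ u ∈ badSet Γ γ ω k,
      (supD x u : ℝ) ≤ theta Γ γ (k + 1) + Γ (k + 1)}.Finite) :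
    Nonempty (GentleDisintegration d G0 Γ γ) := by
  have hθ : ∀ k, 0 ≤ theta Γ γ k := fun k =>
    Finset.sum_nonneg fun i _ => add_nonneg (hΓ i) ((hΓ i).trans (hΓγ i))
  have hB := Bres_gradedAtoms hΓ hΓγ hω
  refine ⟨⟨gradedAtoms Γ γ G0 ω, ?_, ?_, ?_, ?_, ?_, rfl, ?_, ?_, ?_, ?_⟩⟩
  · rintro (_ | k) g hg
    · obtain ⟨x, -, rfl⟩ := hg
      exact Set.finite_singleton x
    · obtain ⟨x, -, rfl⟩ := hg
      exact (finite_ball1 x _).subset Set.inter_subset_left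
  · rintro (_ | k) g hg
    · obtain ⟨x, -, rfl⟩ := hg
      exact Set.singleton_nonempty x
    · obtain ⟨x, hx, rfl⟩ := hg
      exact ⟨x, hx.mem_atom (hΓ _)⟩
  · intro j j' g hg hg'
    have hne : g.Nonempty := by
      cases j with
      | zero => obtain ⟨x, -, rfl⟩ := hg; exact Set.singleton_nonempty x
      | succ k => obtain ⟨x, hx, rfl⟩ := hg; exact ⟨x, hx.mem_atom (hΓ _)⟩
    obtain ⟨x, hx⟩ := hne
    exact grade_unique hΓγ hω hg hg' hx hx
  · intro j j' g g' hg hg' hne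
    rw [Set.disjoint_left]
    intro x hx hx'
    obtain rfl := grade_unique hΓγ hω hg hg' hx hx'
    apply hne
    cases j with
    | zero =>
      obtain ⟨y, -, rfl⟩ := hg
      obtain ⟨z, -, rfl⟩ := hg'
      rw [Set.mem_singleton_iff] at hx hx'
      rw [← hx, ← hx']
    | succ k =>
      obtain ⟨y, hy, rfl⟩ := hg
      obtain ⟨z, hz, rfl⟩ := hg'
      exact (hy.of_mem (hΓγ _) hx).1.symm.trans (hz.of_mem (hΓγ _) hx').1
  · intro x
    by_cases hx : x ∈ G0
    · exact ⟨0, {x}, ⟨x, hx, rfl⟩, rfl⟩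
    · have hex : ∃ k, x ∉ badSet Γ γ ω k := by
        by_contra! hall
        refine (hfin x).not_infinite ?_
        convert Set.infinite_univ (α := ℕ)
        rw [Set.eq_univ_iff_forall]
        intro k
        refine ⟨x, hall k, ?_⟩
        rw [supD_self]
        simpa using add_nonneg (hθ (k + 1)) (hΓ (k + 1))
      have hpos : Nat.find hex ≠ 0 := by
        intro h0
        have := Nat.find_spec hex
        rw [h0] at this
        exact this ((hω x).2 hx)
      obtain ⟨k, hk⟩ := Nat.exists_eq_succ_of_ne_zero hpos
      have h1 : x ∉ badSet Γ γ ω (k + 1) := by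
        have := Nat.find_spec hex
        rwa [hk] at this
      have h2 : x ∈ badSet Γ γ ω k := by
        have := Nat.find_min hex (m := k) (by omega)
        simpa using this
      have hg : gentleOn Γ γ (badSet Γ γ ω k) (k + 1) x := by
        by_contra hcon
        exact h1 ⟨h2, hcon⟩
      exact ⟨k + 1, _, ⟨x, hg, rfl⟩, hg.mem_atom (hΓ _)⟩
  · intro j g hg
    rw [hB]
    obtain ⟨x, -, rfl⟩ := hg
    exact Set.inter_subset_right
  · rintro (_ | k) hj g hg
    · omega
    · obtain ⟨x, hx, rfl⟩ := hg
      exact hx.2.1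
  · intro j g hg
    rw [hB]
    obtain ⟨x, hx, rfl⟩ := hg
    exact hx.2.2
  · intro x
    refine ((hfin x).image (· + 1)).subset ?_
    rintro (_ | k) ⟨hj, g, hg, y, hy, hxy⟩
    · omega
    · refine ⟨k, ?_, rfl⟩
      obtain ⟨u, hu, rfl⟩ := hg
      have hmem := hu.mem_atom (hΓ (k + 1))
      refine ⟨u, hmem.2, ?_⟩
      have hyu : supD y u ≤ ⌊Γ (k + 1)⌋₊ := by
        rw [supD_le_iff]
        intro i
        obtain ⟨⟨v, hv, hvi⟩, w, hw, hwi⟩ := hy i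
        have hb : ∀ z ∈ ball1 u (Γ (k + 1)) ∩ badSet Γ γ ω k,
            (u i - z i).natAbs ≤ ⌊Γ (k + 1)⌋₊ := by
          intro z hz
          refine (natAbs_sub_le_supD u z i).trans ((supD_le_D1 u z).trans (Nat.le_floor hz.1))
        have h1 := hb v hv
        have h2 := hb w hw
        omega
      have h1 : (supD x u : ℝ) ≤ supD x y + supD y u := by
        exact_mod_cast supD_triangle x y u
      have h2 : (supD y u : ℝ) ≤ Γ (k + 1) :=
        (Nat.cast_le.2 hyu).trans (Nat.floor_le (hΓ _))
      linarith

/-! ### Measurability of the multi-scale classification -/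

theorem gentleOn_iff {d : ℕ} (Γ γ : ℕ → ℝ) (B : Set (ZLat d)) (k : ℕ) (x : ZLat d) :
    gentleOn Γ γ B k x ↔ x ∈ B ∧ ∀ u v : ZLat d, u ∈ B → v ∈ B →
      ¬ (u ∈ ball1 x (Γ k) ∧
        (v ∈ ball1 x (Γ k) ∧ Γ k < D1 u v ∨ v ∉ ball1 x (Γ k) ∧ (D1 u v : ℝ) ≤ γ k)) := by
  unfold gentleOn
  refine and_congr_right fun _ => ⟨?_, ?_⟩
  · rintro ⟨h1, h2⟩ u v hu hv ⟨hux, ⟨hvx, h⟩ | ⟨hvx, h⟩⟩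
    · exact absurd (h1 u ⟨hux, hu⟩ v ⟨hvx, hv⟩) (not_le.2 h)
    · exact absurd (h2 u ⟨hux, hu⟩ v ⟨hv, fun h => hvx h.1⟩) (not_lt.2 h)
  · intro h
    refine ⟨fun u hu v hv => ?_, fun u hu v hv => ?_⟩
    · by_contra hcon
      exact h u v hu.2 hv.2 ⟨hu.1, Or.inl ⟨hv.1, not_le.1 hcon⟩⟩
    · by_contra hcon
      exact h u v hu.2 hv.1 ⟨hu.1, Or.inr ⟨fun h => hv.2 ⟨h, hv.1⟩, not_lt.1 hcon⟩⟩

theorem measurableSet_gentleOn {Ω : Type*} [MeasurableSpace Ω] {d : ℕ} {Γ γ : ℕ → ℝ} {k : ℕ}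
    (hγ : 0 ≤ γ k) (B : Ω → Set (ZLat d)) (x : ZLat d)
    (hΓ : 0 ≤ Γ k)
    (hB : ∀ y, (D1 x y : ℝ) ≤ Γ k + γ k → MeasurableSet {a | y ∈ B a}) :
    MeasurableSet {a | gentleOn Γ γ (B a) k x} := by
  simp only [gentleOn_iff]
  refine (hB x ?_).inter (?_ : MeasurableSet {a | ∀ u v : ZLat d, _})
  · rw [D1_self]
    simpa using add_nonneg hΓ hγ
  simp only [Set.ofPred_forall]
  refine MeasurableSet.iInter fun u => MeasurableSet.iInter fun v => ?_
  by_cases hc : u ∈ ball1 x (Γ k) ∧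
        (v ∈ ball1 x (Γ k) ∧ Γ k < D1 u v ∨ v ∉ ball1 x (Γ k) ∧ (D1 u v : ℝ) ≤ γ k)
  · have hu : (D1 x u : ℝ) ≤ Γ k := hc.1
    have hv : (D1 x v : ℝ) ≤ Γ k + γ k := by
      rcases hc.2 with ⟨h, -⟩ | ⟨-, h⟩
      · have h' : (D1 x v : ℝ) ≤ Γ k := h
        linarith
      · have := D1_triangle_real x u v
        linarith
    have := ((hB u (by linarith)).inter (hB v hv)).compl
    convert this using 1
    ext a
    simp only [hc, Set.mem_compl_iff, Set.mem_inter_iff,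
      Set.mem_ofPred_eq]
    tauto
  · simp [hc]

theorem theta_succ (Γ γ : ℕ → ℝ) (k : ℕ) :
    theta Γ γ (k + 1) = theta Γ γ k + (Γ (k + 1) + γ (k + 1)) :=
  Finset.sum_range_succ _ _

theorem measurableSet_mem_badSet {Ω : Type*} [MeasurableSpace Ω] {d : ℕ} {Γ γ : ℕ → ℝ}
    (hΓ : ∀ k, 0 ≤ Γ k) (hγ : ∀ k, 0 ≤ γ k) (ω : Ω → ZLat d → Bool) (k : ℕ) (x : ZLat d)
    (hω : ∀ y, (D1 x y : ℝ) ≤ theta Γ γ k → MeasurableSet {a | ω a y = true}) :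
    MeasurableSet {a | x ∈ badSet Γ γ (ω a) k} := by
  induction k generalizing x with
  | zero =>
    refine hω x ?_
    rw [D1_self]
    simpa [theta] using add_nonneg (hΓ 0) (hγ 0)
  | succ k ih =>
    rw [theta_succ] at hω
    have key : ∀ y, (D1 x y : ℝ) ≤ Γ (k + 1) + γ (k + 1) →
        MeasurableSet {a | y ∈ badSet Γ γ (ω a) k} := by
      intro y hy
      refine ih y fun z hz => hω z ?_
      have := D1_triangle_real x y z
      linarith
    refine (key x ?_).inter (measurableSet_gentleOn (hγ _) _ x (hΓ _) key).compl
    rw [D1_self]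
    simpa using add_nonneg (hΓ (k + 1)) (hγ (k + 1))

theorem measurableSet_mem_atomsAt {Ω : Type*} [MeasurableSpace Ω] {d : ℕ} {Γ γ : ℕ → ℝ}
    (hΓ : ∀ k, 0 ≤ Γ k) (hγ : ∀ k, 0 ≤ γ k) (ω : Ω → ZLat d → Bool) (k : ℕ)
    (X : Set (ZLat d))
    (hω : ∀ x ∈ X, ∀ y, (D1 x y : ℝ) ≤ theta Γ γ (k + 1) →
      MeasurableSet {a | ω a y = true}) :
    MeasurableSet {a | X ∈ atomsAt Γ γ (ω a) (k + 1)} := by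
  have heq : {a | X ∈ atomsAt Γ γ (ω a) (k + 1)} =
      ⋃ x ∈ X, ({a | gentleOn Γ γ (badSet Γ γ (ω a) k) (k + 1) x} ∩
        ⋂ y, {a | y ∈ X ↔ y ∈ ball1 x (Γ (k + 1)) ∧ y ∈ badSet Γ γ (ω a) k}) := by
    ext a
    simp only [atomsAt, Set.mem_ofPred_eq, Set.mem_iUnion, Set.mem_inter_iff, Set.mem_iInter,
      exists_prop, add_tsub_cancel_right]
    constructor
    · rintro ⟨x, hx, rfl⟩
      exact ⟨x, hx.mem_atom (hΓ _), hx, fun y => Iff.rfl⟩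
    · rintro ⟨x, -, hx, h⟩
      exact ⟨x, hx, Set.ext h⟩
  rw [heq]
  refine MeasurableSet.biUnion (Set.to_countable X) fun x hx => ?_
  have key : ∀ y, (D1 x y : ℝ) ≤ Γ (k + 1) + γ (k + 1) →
      MeasurableSet {a | y ∈ badSet Γ γ (ω a) k} := by
    intro y hy
    refine measurableSet_mem_badSet hΓ hγ ω k y fun z hz => hω x hx z ?_
    have := D1_triangle_real x y z
    rw [theta_succ]
    linarith
  refine (measurableSet_gentleOn (hγ _) _ x (hΓ _) key).inter
    (MeasurableSet.iInter fun y => ?_)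
  by_cases hy : y ∈ ball1 x (Γ (k + 1))
  · have hm := key y ((show (D1 x y : ℝ) ≤ Γ (k + 1) from hy).trans (by linarith [hγ (k + 1)]))
    by_cases hyX : y ∈ X
    · simpa [hy, hyX] using hm
    · simp only [hy, hyX, true_and, false_iff]
      exact hm.compl
  · simp [hy]

/-! ### Explicit scales -/

theorem Γex_nonneg (β : ℝ) (k : ℕ) : 0 ≤ Γex β k := by
  unfold Γex
  split_ifs
  · exact le_rfl
  · exact (Real.exp_pos _).le

theorem γex_nonneg (β : ℝ) (k : ℕ) : 0 ≤ γex β k := by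
  unfold γex
  split_ifs
  · exact le_rfl
  · positivity

theorem eight_le_exp_three : (8 : ℝ) ≤ Real.exp 3 := by
  have h2 : (2 : ℝ) ≤ Real.exp 1 := by linarith [Real.add_one_le_exp (1 : ℝ)]
  calc (8 : ℝ) = 2 ^ 3 := by norm_num
    _ ≤ Real.exp 1 ^ 3 := pow_le_pow_left₀ (by norm_num) h2 3
    _ = Real.exp 3 := by rw [← Real.exp_nat_mul]; norm_num

theorem one_le_three_halves_pow (k : ℕ) : (1 : ℝ) ≤ (3 / 2 : ℝ) ^ k :=
  one_le_pow₀ (by norm_num)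

theorem Γex_nine_succ (k : ℕ) : Γex 9 (k + 1) = Real.exp (15 * (3 / 2 : ℝ) ^ k) := by
  simp only [Γex, Nat.add_eq_zero_iff, one_ne_zero, and_false, if_false]
  congr 1
  ring

theorem γex_nine_succ (k : ℕ) :
    γex 9 (k + 1) = (1 / 8 : ℝ) * Real.exp (81 / 4 * (3 / 2 : ℝ) ^ k) := by
  simp only [γex, Nat.add_eq_zero_iff, one_ne_zero, and_false, if_false]
  congr 2
  ring

theorem eight_mul_exp_le {a b : ℝ} (h : a + 3 ≤ b) : 8 * Real.exp a ≤ Real.exp b :=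
  calc 8 * Real.exp a ≤ Real.exp 3 * Real.exp a :=
        mul_le_mul_of_nonneg_right eight_le_exp_three (Real.exp_pos a).le
    _ = Real.exp (a + 3) := by rw [← Real.exp_add]; ring_nf
    _ ≤ Real.exp b := Real.exp_le_exp.2 h

theorem Γex_le_γex (k : ℕ) : Γex 9 k ≤ γex 9 k := by
  cases k with
  | zero => simp [Γex, γex]
  | succ k =>
    rw [Γex_nine_succ, γex_nine_succ]
    have := one_le_three_halves_pow k
    have := eight_mul_exp_le (a := 15 * (3 / 2 : ℝ) ^ k) (b := 81 / 4 * (3 / 2 : ℝ) ^ k)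
      (by linarith)
    linarith

theorem theta_mul_eight_le (k : ℕ) : 8 * theta (Γex 9) (γex 9) k ≤ Γex 9 (k + 1) := by
  induction k with
  | zero =>
    have : theta (Γex 9) (γex 9) 0 = 0 := by simp [theta, Γex, γex]
    rw [this, mul_zero]
    exact Γex_nonneg _ _
  | succ k ih =>
    have h1 := one_le_three_halves_pow k
    have e1 := Γex_nine_succ k
    have e2 := γex_nine_succ k
    have e3 := Γex_nine_succ (k + 1)
    have i1 := eight_mul_exp_le (a := 15 * (3 / 2 : ℝ) ^ k) (b := 18 * (3 / 2 : ℝ) ^ k)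
      (by linarith)
    have i2 := eight_mul_exp_le (a := 18 * (3 / 2 : ℝ) ^ k) (b := 15 * (3 / 2 : ℝ) ^ (k + 1))
      (by rw [pow_succ]; linarith)
    have i3 := eight_mul_exp_le (a := 81 / 4 * (3 / 2 : ℝ) ^ k)
      (b := 15 * (3 / 2 : ℝ) ^ (k + 1) + 3 / 4) (by rw [pow_succ]; linarith)
    have i4 : Real.exp (15 * (3 / 2 : ℝ) ^ (k + 1) + 3 / 4) ≤
        3 * Real.exp (15 * (3 / 2 : ℝ) ^ (k + 1)) := by
      rw [Real.exp_add, mul_comm]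
      refine mul_le_mul_of_nonneg_right ?_ (Real.exp_pos _).le
      exact (Real.exp_le_exp.2 (by norm_num)).trans Real.exp_one_lt_three.le
    have p1 := Real.exp_pos (15 * (3 / 2 : ℝ) ^ k)
    have p2 := Real.exp_pos (15 * (3 / 2 : ℝ) ^ (k + 1))
    rw [theta_succ, e1, e2, e3]
    rw [e1] at ih
    linarith

theorem theta_nonneg (k : ℕ) : 0 ≤ theta (Γex 9) (γex 9) k :=
  Finset.sum_nonneg fun i _ => add_nonneg (Γex_nonneg _ i) (γex_nonneg _ i)

/-- A crude bound for the number of sites relevant at scale `k + 1`. -/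
theorem two_mul_scale_add_one_le (k : ℕ) :
    2 * (theta (Γex 9) (γex 9) (k + 1) + Γex 9 (k + 1)) + 1 ≤
      Real.exp (23 * (3 / 2 : ℝ) ^ k) := by
  have h1 := one_le_three_halves_pow k
  have e1 := Γex_nine_succ k
  have h2 := theta_mul_eight_le (k + 1)
  rw [Γex_nine_succ, pow_succ] at h2
  have i1 := eight_mul_exp_le (a := 15 * (3 / 2 : ℝ) ^ k) (b := 18 * (3 / 2 : ℝ) ^ k)
    (by linarith)
  have i2 := eight_mul_exp_le (a := 18 * (3 / 2 : ℝ) ^ k) (b := 23 * (3 / 2 : ℝ) ^ k)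
    (by linarith)
  have i3 : Real.exp (15 * ((3 / 2 : ℝ) ^ k * (3 / 2))) ≤ Real.exp (23 * (3 / 2 : ℝ) ^ k) :=
    Real.exp_le_exp.2 (by linarith)
  have p1 : 1 ≤ Real.exp (15 * (3 / 2 : ℝ) ^ k) := Real.one_le_exp (by positivity)
  linarith

/-! ### Witness trees for bad points -/

/-- Sites within sup-distance `Γ_{k+1} + γ_{k+1}` of `x`, at `ℓ¹` distance more than
`Γ_{k+1} / 2` from `x`. -/
def annulus {d : ℕ} (Γ γ : ℕ → ℝ) (k : ℕ) (x : ZLat d) : Finset (ZLat d) :=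
  (box x ⌊Γ (k + 1) + γ (k + 1)⌋₊).filter fun v =>
    Γ (k + 1) / 2 < D1 x v ∧ (D1 x v : ℝ) ≤ Γ (k + 1) + γ (k + 1)

theorem exists_mem_annulus {d : ℕ} {Γ γ : ℕ → ℝ} (hΓ : ∀ k, 0 ≤ Γ k) (hγ : ∀ k, 0 ≤ γ k)
    {ω : ZLat d → Bool} {k : ℕ} {x : ZLat d} (hx : x ∈ badSet Γ γ ω (k + 1)) :
    ∃ v ∈ annulus Γ γ k x, v ∈ badSet Γ γ ω k := by
  obtain ⟨hxk, hng⟩ := hx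
  have hΓ' := hΓ (k + 1)
  have hγ' := hγ (k + 1)
  suffices h : ∃ v ∈ badSet Γ γ ω k, Γ (k + 1) / 2 < D1 x v ∧
      (D1 x v : ℝ) ≤ Γ (k + 1) + γ (k + 1) by
    obtain ⟨v, hv, h1, h2⟩ := h
    refine ⟨v, Finset.mem_filter.2 ⟨mem_box.2 ?_, h1, h2⟩, hv⟩
    exact (supD_le_D1 x v).trans (Nat.le_floor h2)
  rw [gentleOn_iff] at hng
  push Not at hng
  obtain ⟨u, v, hu, hv, hux, h⟩ := hng hxk
  have hux' : (D1 x u : ℝ) ≤ Γ (k + 1) := hux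
  rcases h with ⟨hvx, h⟩ | ⟨hvx, h⟩
  · have hvx' : (D1 x v : ℝ) ≤ Γ (k + 1) := hvx
    have htri := D1_triangle_real u x v
    rw [D1_comm u x] at htri
    by_cases hc : Γ (k + 1) / 2 < D1 x v
    · exact ⟨v, hv, hc, by linarith⟩
    · exact ⟨u, hu, by linarith, by linarith⟩
  · have hvx' : Γ (k + 1) < (D1 x v : ℝ) := not_le.1 hvx
    have htri := D1_triangle_real x u v
    exact ⟨v, hv, by linarith, by linarith⟩

/-- The possible supports, of cardinality `2^k`, of the initially bad points witnessing that
`x` is `k`-bad. -/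
def witnesses {d : ℕ} (Γ γ : ℕ → ℝ) : ℕ → ZLat d → Finset (Finset (ZLat d))
  | 0, x => {{x}}
  | k + 1, x => (annulus Γ γ k x).biUnion fun v =>
      (witnesses Γ γ k x ×ˢ witnesses Γ γ k v).image fun p => p.1 ∪ p.2

theorem exists_witness {d : ℕ} {Γ γ : ℕ → ℝ} (hΓ : ∀ k, 0 ≤ Γ k) (hγ : ∀ k, 0 ≤ γ k)
    {ω : ZLat d → Bool} (k : ℕ) {x : ZLat d} (hx : x ∈ badSet Γ γ ω k) :
    ∃ A ∈ witnesses Γ γ k x, ∀ y ∈ A, ω y = true := by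
  induction k generalizing x with
  | zero => exact ⟨{x}, by simp [witnesses], by simpa [badSet] using hx⟩
  | succ k ih =>
    obtain ⟨v, hv, hvk⟩ := exists_mem_annulus hΓ hγ hx
    obtain ⟨A, hA, hAω⟩ := ih hx.1
    obtain ⟨A', hA', hAω'⟩ := ih hvk
    refine ⟨A ∪ A', ?_, ?_⟩
    · simp only [witnesses, Finset.mem_biUnion, Finset.mem_image]
      exact ⟨v, hv, (A, A'), Finset.mem_product.2 ⟨hA, hA'⟩, rfl⟩
    · intro y hy
      rcases Finset.mem_union.1 hy with h | h
      exacts [hAω y h, hAω' y h]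

theorem witness_near {d : ℕ} {Γ γ : ℕ → ℝ} (hΓ : ∀ k, 0 ≤ Γ k) (hγ : ∀ k, 0 ≤ γ k) (k : ℕ)
    {x : ZLat d} {A : Finset (ZLat d)} (hA : A ∈ witnesses Γ γ k x) {y : ZLat d}
    (hy : y ∈ A) : (D1 x y : ℝ) ≤ theta Γ γ k := by
  induction k generalizing x A with
  | zero =>
    simp only [witnesses, Finset.mem_singleton] at hA
    rw [hA, Finset.mem_singleton] at hy
    rw [hy, D1_self]
    simpa [theta] using add_nonneg (hΓ 0) (hγ 0)
  | succ k ih =>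
    simp only [witnesses, Finset.mem_biUnion, Finset.mem_image] at hA
    obtain ⟨v, hv, ⟨A₁, A₂⟩, hp, rfl⟩ := hA
    obtain ⟨h1, h2⟩ := Finset.mem_product.1 hp
    rw [theta_succ]
    have := hΓ (k + 1)
    have := hγ (k + 1)
    rcases Finset.mem_union.1 hy with h | h
    · linarith [ih h1 h]
    · have hv' := (Finset.mem_filter.1 hv).2.2
      linarith [ih h2 h, D1_triangle_real x v y]

theorem card_witness {d : ℕ} {Γ γ : ℕ → ℝ} (hΓ : ∀ k, 0 ≤ Γ k) (hγ : ∀ k, 0 ≤ γ k)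
    (hθ : ∀ k, 4 * theta Γ γ k ≤ Γ (k + 1)) (k : ℕ)
    {x : ZLat d} {A : Finset (ZLat d)} (hA : A ∈ witnesses Γ γ k x) : A.card = 2 ^ k := by
  induction k generalizing x A with
  | zero =>
    simp only [witnesses, Finset.mem_singleton] at hA
    simp [hA]
  | succ k ih =>
    simp only [witnesses, Finset.mem_biUnion, Finset.mem_image] at hA
    obtain ⟨v, hv, ⟨A₁, A₂⟩, hp, rfl⟩ := hA
    obtain ⟨h1, h2⟩ := Finset.mem_product.1 hp
    have hdisj : Disjoint A₁ A₂ := by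
      rw [Finset.disjoint_left]
      intro y hy1 hy2
      have hv' := (Finset.mem_filter.1 hv).2.1
      have n1 := witness_near hΓ hγ k h1 hy1
      have n2 := witness_near hΓ hγ k h2 hy2
      have := D1_triangle_real x y v
      rw [D1_comm y v] at this
      linarith [hθ k]
    rw [Finset.card_union_of_disjoint hdisj, ih h1, ih h2]
    ring

theorem card_annulus_le {d : ℕ} (k : ℕ) (x : ZLat d) :
    ((annulus (Γex 9) (γex 9) k x).card : ℝ) ≤ Real.exp (23 * d * (3 / 2 : ℝ) ^ k) := by
  have hn : 0 ≤ Γex 9 (k + 1) + γex 9 (k + 1) :=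
    add_nonneg (Γex_nonneg _ _) (γex_nonneg _ _)
  calc ((annulus (Γex 9) (γex 9) k x).card : ℝ)
      ≤ ((box x ⌊Γex 9 (k + 1) + γex 9 (k + 1)⌋₊).card : ℝ) := by
        exact_mod_cast Finset.card_filter_le _ _
    _ = (2 * (⌊Γex 9 (k + 1) + γex 9 (k + 1)⌋₊ : ℝ) + 1) ^ d := by
        rw [card_box]; push_cast; rfl
    _ ≤ (2 * (theta (Γex 9) (γex 9) (k + 1) + Γex 9 (k + 1)) + 1) ^ d := by
        refine pow_le_pow_left₀ (by positivity) ?_ d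
        have := Nat.floor_le hn
        have := theta_nonneg k
        have := Γex_nonneg 9 (k + 1)
        rw [theta_succ]
        linarith
    _ ≤ Real.exp (23 * (3 / 2 : ℝ) ^ k) ^ d := by
        refine pow_le_pow_left₀ ?_ (two_mul_scale_add_one_le k) d
        have := theta_nonneg (k + 1)
        have := Γex_nonneg 9 (k + 1)
        linarith
    _ = Real.exp (23 * d * (3 / 2 : ℝ) ^ k) := by
        rw [← Real.exp_nat_mul]; ring_nf

theorem card_witnesses_le {d : ℕ} (k : ℕ) (x : ZLat d) :
    ((witnesses (Γex 9) (γex 9) k x).card : ℝ) ≤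
      Real.exp (46 * d * (2 ^ k - (3 / 2 : ℝ) ^ k)) := by
  induction k generalizing x with
  | zero => simp [witnesses]
  | succ k ih =>
    have hcard : (witnesses (Γex 9) (γex 9) (k + 1) x).card ≤
        ∑ v ∈ annulus (Γex 9) (γex 9) k x,
          (witnesses (Γex 9) (γex 9) k x).card * (witnesses (Γex 9) (γex 9) k v).card := by
      refine Finset.card_biUnion_le.trans (Finset.sum_le_sum fun v _ => ?_)
      rw [← Finset.card_product]
      exact Finset.card_image_le
    set E := Real.exp (46 * d * (2 ^ k - (3 / 2 : ℝ) ^ k)) with hE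
    calc ((witnesses (Γex 9) (γex 9) (k + 1) x).card : ℝ)
        ≤ ∑ v ∈ annulus (Γex 9) (γex 9) k x,
          ((witnesses (Γex 9) (γex 9) k x).card : ℝ) *
            (witnesses (Γex 9) (γex 9) k v).card := by exact_mod_cast hcard
      _ ≤ ∑ v ∈ annulus (Γex 9) (γex 9) k x, E * E :=
          Finset.sum_le_sum fun v _ => mul_le_mul (ih x) (ih v) (by positivity) (by positivity)
      _ = (annulus (Γex 9) (γex 9) k x).card * (E * E) := by
          rw [Finset.sum_const, nsmul_eq_mul]
      _ ≤ Real.exp (23 * d * (3 / 2 : ℝ) ^ k) * (E * E) :=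
          mul_le_mul_of_nonneg_right (card_annulus_le k x) (by positivity)
      _ = Real.exp (46 * d * (2 ^ (k + 1) - (3 / 2 : ℝ) ^ (k + 1))) := by
          rw [hE, ← Real.exp_add, ← Real.exp_add]
          congr 1
          ring

/-! ### Almost sure finiteness -/

/-- If all sites of a finite set are simultaneously bad with probability exponentially small in
the cardinality, then being `k`-bad has doubly exponentially small probability. -/
theorem measure_mem_badSet_le {Ω : Type*} [MeasurableSpace Ω] (P : Measure Ω) {d : ℕ}
    (ω : Ω → ZLat d → Bool) {q : ℝ} (hq : 0 ≤ q)
    (hP : ∀ A : Finset (ZLat d), P {a | ∀ t ∈ A, ω a t = true} ≤ ENNReal.ofReal (q ^ A.card))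
    (k : ℕ) (x : ZLat d) :
    P {a | x ∈ badSet (Γex 9) (γex 9) (ω a) k} ≤
      ENNReal.ofReal ((Real.exp (46 * d) * q) ^ 2 ^ k) := by
  have hΓ := Γex_nonneg 9
  have hγ := γex_nonneg 9
  have hsub : {a | x ∈ badSet (Γex 9) (γex 9) (ω a) k} ⊆
      ⋃ A ∈ witnesses (Γex 9) (γex 9) k x, {a | ∀ t ∈ A, ω a t = true} := by
    intro a ha
    obtain ⟨A, hA, h⟩ := exists_witness hΓ hγ k ha
    exact Set.mem_biUnion hA h
  calc P {a | x ∈ badSet (Γex 9) (γex 9) (ω a) k}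
      ≤ ∑ A ∈ witnesses (Γex 9) (γex 9) k x, P {a | ∀ t ∈ A, ω a t = true} :=
        (measure_mono hsub).trans (measure_biUnion_finset_le _ _)
    _ ≤ ∑ A ∈ witnesses (Γex 9) (γex 9) k x, ENNReal.ofReal (q ^ 2 ^ k) := by
        refine Finset.sum_le_sum fun A hA => (hP A).trans (le_of_eq ?_)
        rw [card_witness hΓ hγ (fun k => ?_) k hA]
        linarith [theta_mul_eight_le k, theta_nonneg k]
    _ = ENNReal.ofReal ((witnesses (Γex 9) (γex 9) k x).card * q ^ 2 ^ k) := by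
        rw [Finset.sum_const, nsmul_eq_mul, ENNReal.ofReal_mul (by positivity),
          ENNReal.ofReal_natCast]
    _ ≤ ENNReal.ofReal ((Real.exp (46 * d) * q) ^ 2 ^ k) := by
        refine ENNReal.ofReal_le_ofReal ?_
        rw [mul_pow, ← Real.exp_nat_mul]
        refine mul_le_mul_of_nonneg_right ((card_witnesses_le k x).trans
          (Real.exp_le_exp.2 ?_)) (by positivity)
        push_cast
        have : (0 : ℝ) ≤ 46 * d * (3 / 2 : ℝ) ^ k := by positivity
        linarith

/-- Almost surely, every site is close to the `k`-bad set for finitely many `k` only. -/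
theorem ae_finite_near_badSet {Ω : Type*} [MeasurableSpace Ω] (P : Measure Ω) {d : ℕ}
    (ω : Ω → ZLat d → Bool) {q : ℝ} (hq : 0 ≤ q) (hq' : Real.exp (69 * d) * q ≤ 1 / 2)
    (hP : ∀ A : Finset (ZLat d), P {a | ∀ t ∈ A, ω a t = true} ≤ ENNReal.ofReal (q ^ A.card)) :
    ∀ᵐ a ∂P, ∀ x : ZLat d, {k : ℕ | ∃ u ∈ badSet (Γex 9) (γex 9) (ω a) k,
      (supD x u : ℝ) ≤ theta (Γex 9) (γex 9) (k + 1) + Γex 9 (k + 1)}.Finite := by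
  rw [ae_all_iff]
  intro x
  refine ae_finite_setOfPred_mem (s := fun k => {a | ∃ u ∈ badSet (Γex 9) (γex 9) (ω a) k,
      (supD x u : ℝ) ≤ theta (Γex 9) (γex 9) (k + 1) + Γex 9 (k + 1)}) (ne_of_lt ?_)
  have hbound : ∀ k : ℕ, P {a | ∃ u ∈ badSet (Γex 9) (γex 9) (ω a) k,
      (supD x u : ℝ) ≤ theta (Γex 9) (γex 9) (k + 1) + Γex 9 (k + 1)} ≤
      ENNReal.ofReal ((1 / 2) ^ k) := by
    intro k
    set R := theta (Γex 9) (γex 9) (k + 1) + Γex 9 (k + 1) with hR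
    have hR0 : 0 ≤ R := add_nonneg (theta_nonneg _) (Γex_nonneg _ _)
    have hsub : {a | ∃ u ∈ badSet (Γex 9) (γex 9) (ω a) k, (supD x u : ℝ) ≤ R} ⊆
        ⋃ u ∈ box x ⌊R⌋₊, {a | u ∈ badSet (Γex 9) (γex 9) (ω a) k} := by
      rintro a ⟨u, hu, hxu⟩
      exact Set.mem_biUnion (mem_box.2 (Nat.le_floor hxu)) hu
    calc P {a | ∃ u ∈ badSet (Γex 9) (γex 9) (ω a) k, (supD x u : ℝ) ≤ R}
        ≤ ∑ u ∈ box x ⌊R⌋₊, P {a | u ∈ badSet (Γex 9) (γex 9) (ω a) k} :=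
          (measure_mono hsub).trans (measure_biUnion_finset_le _ _)
      _ ≤ ∑ u ∈ box x ⌊R⌋₊, ENNReal.ofReal ((Real.exp (46 * d) * q) ^ 2 ^ k) :=
          Finset.sum_le_sum fun u _ => measure_mem_badSet_le P ω hq hP k u
      _ = ENNReal.ofReal ((box x ⌊R⌋₊).card * (Real.exp (46 * d) * q) ^ 2 ^ k) := by
          rw [Finset.sum_const, nsmul_eq_mul, ENNReal.ofReal_mul (by positivity),
            ENNReal.ofReal_natCast]
      _ ≤ ENNReal.ofReal ((1 / 2) ^ k) := by
          refine ENNReal.ofReal_le_ofReal ?_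
          have hc : ((box x ⌊R⌋₊).card : ℝ) ≤ Real.exp (23 * d) ^ 2 ^ k := by
            rw [card_box]
            push_cast
            calc (2 * (⌊R⌋₊ : ℝ) + 1) ^ d ≤ Real.exp (23 * (3 / 2 : ℝ) ^ k) ^ d := by
                  refine pow_le_pow_left₀ (by positivity) ?_ d
                  have := Nat.floor_le hR0
                  linarith [two_mul_scale_add_one_le k]
              _ ≤ Real.exp (23 * 2 ^ k) ^ d := by
                  refine pow_le_pow_left₀ (Real.exp_pos _).le (Real.exp_le_exp.2 ?_) d
                  have : (3 / 2 : ℝ) ^ k ≤ 2 ^ k :=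
                    pow_le_pow_left₀ (by norm_num) (by norm_num) k
                  linarith
              _ = Real.exp (23 * d) ^ 2 ^ k := by
                  rw [← Real.exp_nat_mul, ← Real.exp_nat_mul]
                  push_cast
                  ring_nf
          calc ((box x ⌊R⌋₊).card : ℝ) * (Real.exp (46 * d) * q) ^ 2 ^ k
              ≤ Real.exp (23 * d) ^ 2 ^ k * (Real.exp (46 * d) * q) ^ 2 ^ k :=
                mul_le_mul_of_nonneg_right hc (by positivity)
            _ = (Real.exp (69 * d) * q) ^ 2 ^ k := by
                rw [← mul_pow, ← mul_assoc, ← Real.exp_add]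
                ring_nf
            _ ≤ (1 / 2) ^ 2 ^ k := pow_le_pow_left₀ (by positivity) hq' _
            _ ≤ (1 / 2) ^ k :=
                pow_le_pow_of_le_one (by norm_num) (by norm_num) Nat.lt_two_pow_self.le
  refine (ENNReal.tsum_le_tsum hbound).trans_lt ?_
  rw [← ENNReal.ofReal_tsum_of_nonneg (fun k => by positivity)
    (summable_geometric_of_lt_one (by norm_num) (by norm_num))]
  exact ENNReal.ofReal_lt_top

/-! ### Local functions -/

theorem override_of_mem {d : ℕ} {Λ : Finset (ZLat d)} (s : ↥Λ → Bool) (τ : GConf d)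
    {x : ZLat d} (h : x ∈ Λ) : override Λ s τ x = s ⟨x, h⟩ := by
  simp [override, h]

theorem override_of_notMem {d : ℕ} {Λ : Finset (ZLat d)} (s : ↥Λ → Bool) (τ : GConf d)
    {x : ZLat d} (h : x ∉ Λ) : override Λ s τ x = τ x := by
  simp [override, h]

theorem LocalOn.eq_override {d : ℕ} {f : GConf d → ℝ} {S : Finset (ZLat d)}
    (hf : LocalOn f S) (σ : GConf d) :
    f σ = f (override S (fun x => σ x) fun _ => false) :=
  hf _ _ fun x hx => by rw [override_of_mem _ _ hx]

theorem LocalOn.measurable {d : ℕ} {f : GConf d → ℝ} {S : Finset (ZLat d)}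
    (hf : LocalOn f S) : Measurable f := by
  have h : f = (fun s : ↥S → Bool => f (override S s fun _ => false)) ∘
      fun σ (x : ↥S) => σ x := funext hf.eq_override
  rw [h]
  exact (measurable_of_countable _).comp
    (measurable_pi_lambda _ fun x => measurable_pi_apply _)

theorem LocalOn.bddAbove_abs {d : ℕ} {f : GConf d → ℝ} {S : Finset (ZLat d)}
    (hf : LocalOn f S) : BddAbove (Set.range fun σ => |f σ|) := by
  refine ((Set.finite_range
    fun s : ↥S → Bool => |f (override S s fun _ => false)|).subset ?_).bddAbove
  rintro _ ⟨σ, rfl⟩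
  refine ⟨fun x => σ x, ?_⟩
  simp only
  rw [← hf.eq_override]

theorem LocalOn.abs_le_supNorm {d : ℕ} {f : GConf d → ℝ} {S : Finset (ZLat d)}
    (hf : LocalOn f S) (σ : GConf d) : |f σ| ≤ supNorm f :=
  le_ciSup hf.bddAbove_abs σ

theorem LocalOn.integrable {d : ℕ} {f : GConf d → ℝ} {S : Finset (ZLat d)}
    (hf : LocalOn f S) (μ : Measure (GConf d)) [IsProbabilityMeasure μ] : Integrable f μ :=
  Integrable.of_bound hf.measurable.aestronglyMeasurable (supNorm f)
    (Filter.Eventually.of_forall fun σ => by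
      rw [Real.norm_eq_abs]; exact hf.abs_le_supNorm σ)

theorem supNorm_nonneg {α : Type*} (f : α → ℝ) : 0 ≤ supNorm f :=
  Real.iSup_nonneg fun _ => abs_nonneg _

theorem supNorm_le {α : Type*} [Nonempty α] {f : α → ℝ} {C : ℝ} (h : ∀ a, |f a| ≤ C) :
    supNorm f ≤ C := ciSup_le h

theorem occ_nonneg {d : ℕ} (x : ZLat d) (σ : GConf d) : 0 ≤ occ x σ := by
  unfold occ; split_ifs <;> norm_num

theorem occ_le_one {d : ℕ} (x : ZLat d) (σ : GConf d) : occ x σ ≤ 1 := by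
  unfold occ; split_ifs <;> norm_num

theorem localOn_occ {d : ℕ} (x : ZLat d) : LocalOn (occ x) {x} := fun σ τ h => by
  unfold occ
  rw [h x (Finset.mem_singleton_self x)]

theorem supNorm_occ_le {d : ℕ} (x : ZLat d) : supNorm (occ x) ≤ 1 :=
  supNorm_le fun σ => by rw [abs_of_nonneg (occ_nonneg x σ)]; exact occ_le_one x σ

/-! ### The potential and the Hamiltonian -/

/-- The `r`-neighbourhood of `Λ`. -/
def nbhd {d : ℕ} (Λ : Finset (ZLat d)) (r : ℕ) : Finset (ZLat d) :=
  Λ.biUnion fun x => box x r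

theorem localOn_gasPotH {d : ℕ} (G : LatticeGas d) (X : Finset (ZLat d)) :
    LocalOn (gasPotH G X) X := by
  intro σ τ h
  unfold gasPotH gasPot
  split_ifs
  · refine Finset.sum_congr rfl fun x hx => ?_
    rw [h x hx]
  · exact G.Ulocal X σ τ h

theorem gasPotH_eq_zero {d : ℕ} (G : LatticeGas d) {X : Finset (ZLat d)} {x y : ZLat d}
    (hx : x ∈ X) (hy : y ∈ X) (hxy : G.r < supD x y) (σ : GConf d) : gasPotH G X σ = 0 := by
  have hne : x ≠ y := by
    rintro rfl
    rw [supD_self] at hxy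
    omega
  unfold gasPotH gasPot
  rw [if_neg, G.Urange X x hx y hy hxy]
  · rfl
  · have := Finset.one_lt_card.2 ⟨x, hx, y, hy, hne⟩
    omega

theorem gasPotH_eq_zero_of_not_subset {d : ℕ} (G : LatticeGas d) {X Λ : Finset (ZLat d)}
    (h : (X ∩ Λ).Nonempty) (hX : ¬ X ⊆ nbhd Λ G.r) (σ : GConf d) : gasPotH G X σ = 0 := by
  obtain ⟨x, hx⟩ := h
  obtain ⟨hxX, hxΛ⟩ := Finset.mem_inter.1 hx
  obtain ⟨y, hy, hyn⟩ := Finset.not_subset.1 hX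
  refine gasPotH_eq_zero G hxX hy ?_ σ
  by_contra hcon
  exact hyn (Finset.mem_biUnion.2 ⟨x, hxΛ, mem_box.2 (not_lt.1 hcon)⟩)

theorem hamil_term_eq_zero {d : ℕ} (G : LatticeGas d) {X Λ : Finset (ZLat d)}
    (hX : X ∉ (nbhd Λ G.r).powerset) (σ : GConf d) :
    (if (X ∩ Λ).Nonempty then gasPotH G X σ else 0) = 0 := by
  split_ifs with h
  · exact gasPotH_eq_zero_of_not_subset G h (fun hs => hX (Finset.mem_powerset.2 hs)) σ
  · rfl

theorem hamil_eq_sum {d : ℕ} (G : LatticeGas d) (Λ : Finset (ZLat d)) (σ : GConf d) :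
    hamil (gasPotH G) Λ σ = ∑ X ∈ (nbhd Λ G.r).powerset,
      if (X ∩ Λ).Nonempty then gasPotH G X σ else 0 :=
  tsum_eq_sum fun _ hX => hamil_term_eq_zero G hX σ

theorem localOn_hamil {d : ℕ} (G : LatticeGas d) (Λ : Finset (ZLat d)) :
    LocalOn (hamil (gasPotH G) Λ) (nbhd Λ G.r) := by
  intro σ τ h
  rw [hamil_eq_sum, hamil_eq_sum]
  refine Finset.sum_congr rfl fun X hX => ?_
  rw [localOn_gasPotH G X σ τ fun x hx => h x (Finset.mem_powerset.1 hX hx)]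

/-- Changing the configuration at a single site `y` outside `Λ` changes the energy through
finitely many interaction terms near `y`. -/
theorem hamil_sub_hamil {d : ℕ} (G : LatticeGas d) {Λ : Finset (ZLat d)} {y : ZLat d}
    (hy : y ∉ Λ) {σ σ' : GConf d} (h : ∀ x, x ≠ y → σ x = σ' x) :
    hamil (gasPotH G) Λ σ - hamil (gasPotH G) Λ σ' =
      ∑ X ∈ (box y G.r).powerset, if (X ∩ Λ).Nonempty ∧ y ∈ X then G.U X σ - G.U X σ' else 0 := by
  unfold hamil
  have hs : ∀ σ : GConf d, Summable fun X : Finset (ZLat d) =>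
      if (X ∩ Λ).Nonempty then gasPotH G X σ else 0 := fun σ =>
    summable_of_ne_finset_zero fun X hX => hamil_term_eq_zero G hX σ
  rw [← (hs σ).tsum_sub (hs σ')]
  have hterm : ∀ X : Finset (ZLat d),
      ((if (X ∩ Λ).Nonempty then gasPotH G X σ else 0) -
        (if (X ∩ Λ).Nonempty then gasPotH G X σ' else 0)) =
      if (X ∩ Λ).Nonempty ∧ y ∈ X then G.U X σ - G.U X σ' else 0 := by
    intro X
    by_cases hX : (X ∩ Λ).Nonempty
    · by_cases hyX : y ∈ X
      · obtain ⟨x, hx⟩ := hX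
        obtain ⟨hxX, hxΛ⟩ := Finset.mem_inter.1 hx
        have hc : X.card ≠ 1 := by
          have : x ≠ y := by rintro rfl; exact hy hxΛ
          have := Finset.one_lt_card.2 ⟨x, hxX, y, hyX, this⟩
          omega
        have hX : (X ∩ Λ).Nonempty := ⟨x, hx⟩
        simp [hX, hyX, gasPotH, gasPot, hc]
      · rw [localOn_gasPotH G X σ σ' fun x hx => h x (by rintro rfl; exact hyX hx)]
        simp [hyX]
    · simp [hX]
  simp only [hterm]
  refine tsum_eq_sum fun X hX => ?_
  split_ifs with hc
  · rw [Finset.mem_powerset, Finset.not_subset] at hX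
    obtain ⟨z, hz, hzy⟩ := hX
    rw [mem_box, not_le] at hzy
    rw [G.Urange X y hc.2 z hz hzy]
    simp
  · rfl

/-- Bound for the energy change due to modifying the configuration at a single site. -/
def flipBound {d : ℕ} (G : LatticeGas d) : ℝ :=
  ∑ X ∈ (box (0 : ZLat d) G.r).powerset, 2 * supNorm (G.U X)

theorem supNorm_U_translate_le {d : ℕ} (G : LatticeGas d) (X : Finset (ZLat d)) (y : ZLat d) :
    supNorm (G.U (X.image (· + y))) ≤ supNorm (G.U X) :=
  supNorm_le fun σ => by
    rw [G.UtransInv]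
    exact (G.Ulocal X).abs_le_supNorm _

theorem sum_supNorm_le_flipBound {d : ℕ} (G : LatticeGas d) (y : ZLat d) :
    ∑ X ∈ (box y G.r).powerset, 2 * supNorm (G.U X) ≤ flipBound G := by
  have himg : (box y G.r).powerset =
      (box (0 : ZLat d) G.r).powerset.image fun X => X.image (· + y) := by
    ext X
    simp only [Finset.mem_powerset, Finset.mem_image]
    constructor
    · intro h
      refine ⟨X.image (· - y), ?_, ?_⟩
      · intro z hz
        obtain ⟨w, hw, rfl⟩ := Finset.mem_image.1 hz
        have := mem_box.1 (h hw)
        rw [supD_le_iff] at this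
        rw [mem_box, supD_le_iff]
        intro i
        have := this i
        simp only [Pi.zero_apply, Pi.sub_apply]
        omega
      · have : ((fun z : ZLat d => z + y) ∘ fun z => z - y) = id := by
          funext z
          simp
        rw [Finset.image_image, this, Finset.image_id]
    · rintro ⟨Y, hY, rfl⟩ z hz
      obtain ⟨w, hw, rfl⟩ := Finset.mem_image.1 hz
      have := mem_box.1 (hY hw)
      rw [supD_le_iff] at this
      rw [mem_box, supD_le_iff]
      intro i
      have := this i
      simp only [Pi.zero_apply, Pi.add_apply] at this ⊢
      omega
  rw [himg, Finset.sum_image]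
  · exact Finset.sum_le_sum fun X _ =>
      mul_le_mul_of_nonneg_left (supNorm_U_translate_le G X y) (by norm_num)
  · exact (Finset.image_injective (add_left_injective y)).injOn

theorem abs_hamil_sub_hamil_le {d : ℕ} (G : LatticeGas d) {Λ : Finset (ZLat d)} {y : ZLat d}
    (hy : y ∉ Λ) {σ σ' : GConf d} (h : ∀ x, x ≠ y → σ x = σ' x) :
    |hamil (gasPotH G) Λ σ - hamil (gasPotH G) Λ σ'| ≤ flipBound G := by
  rw [hamil_sub_hamil G hy h]
  refine (Finset.abs_sum_le_sum_abs _ _).trans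
    ((Finset.sum_le_sum fun X _ => ?_).trans (sum_supNorm_le_flipBound G y))
  have h1 := (G.Ulocal X).abs_le_supNorm σ
  have h2 := (G.Ulocal X).abs_le_supNorm σ'
  have h3 := supNorm_nonneg (G.U X)
  split_ifs
  · calc |G.U X σ - G.U X σ'| ≤ |G.U X σ| + |G.U X σ'| := abs_sub _ _
      _ ≤ 2 * supNorm (G.U X) := by linarith
  · simpa using h3

/-! ### Finite volume Gibbs measures as finite weighted sums -/

/-- The weight of a configuration on `Λ` under the finite volume Gibbs measure. -/
def gibbsWeight {d : ℕ} (Φ : Finset (ZLat d) → GConf d → ℝ) (Λ : Finset (ZLat d))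
    (τ : GConf d) (s : ↥Λ → Bool) : ℝ :=
  Real.exp (hamil Φ Λ (override Λ s τ)) / partFun Φ Λ τ

section

variable {d : ℕ} (Φ : Finset (ZLat d) → GConf d → ℝ) (Λ : Finset (ZLat d)) (τ : GConf d)

theorem partFun_pos : 0 < partFun Φ Λ τ :=
  Finset.sum_pos (fun _ _ => Real.exp_pos _) Finset.univ_nonempty

theorem gibbsWeight_nonneg (s : ↥Λ → Bool) : 0 ≤ gibbsWeight Φ Λ τ s :=
  div_nonneg (Real.exp_pos _).le (partFun_pos Φ Λ τ).le

theorem sum_gibbsWeight : ∑ s, gibbsWeight Φ Λ τ s = 1 := by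
  unfold gibbsWeight
  rw [← Finset.sum_div]
  exact div_self (partFun_pos Φ Λ τ).ne'

theorem gibbsExp_eq (f : GConf d → ℝ) :
    gibbsExp Φ Λ τ f = ∑ s, gibbsWeight Φ Λ τ s * f (override Λ s τ) := by
  unfold gibbsExp gibbsWeight
  rw [Finset.sum_div]
  exact Finset.sum_congr rfl fun s _ => by ring

theorem gibbsExp_mono {f g : GConf d → ℝ} (h : ∀ s, f (override Λ s τ) ≤ g (override Λ s τ)) :
    gibbsExp Φ Λ τ f ≤ gibbsExp Φ Λ τ g := by
  rw [gibbsExp_eq, gibbsExp_eq]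
  exact Finset.sum_le_sum fun s _ =>
    mul_le_mul_of_nonneg_left (h s) (gibbsWeight_nonneg Φ Λ τ s)

theorem gibbsExp_nonneg {f : GConf d → ℝ} (h : ∀ σ, 0 ≤ f σ) : 0 ≤ gibbsExp Φ Λ τ f := by
  rw [gibbsExp_eq]
  exact Finset.sum_nonneg fun s _ => mul_nonneg (gibbsWeight_nonneg Φ Λ τ s) (h _)

theorem gibbsExp_const (c : ℝ) : gibbsExp Φ Λ τ (fun _ => c) = c := by
  rw [gibbsExp_eq, ← Finset.sum_mul, sum_gibbsWeight, one_mul]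

theorem gibbsExp_const_mul (c : ℝ) (f : GConf d → ℝ) :
    gibbsExp Φ Λ τ (fun σ => c * f σ) = c * gibbsExp Φ Λ τ f := by
  rw [gibbsExp_eq, gibbsExp_eq, Finset.mul_sum]
  exact Finset.sum_congr rfl fun s _ => by ring

theorem gibbsExp_add (f g : GConf d → ℝ) :
    gibbsExp Φ Λ τ (fun σ => f σ + g σ) = gibbsExp Φ Λ τ f + gibbsExp Φ Λ τ g := by
  simp only [gibbsExp_eq, mul_add, Finset.sum_add_distrib]

theorem gibbsExp_sum {ι : Type*} (A : Finset ι) (f : ι → GConf d → ℝ) :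
    gibbsExp Φ Λ τ (fun σ => ∑ i ∈ A, f i σ) = ∑ i ∈ A, gibbsExp Φ Λ τ (f i) := by
  simp only [gibbsExp_eq, Finset.mul_sum]
  exact Finset.sum_comm

/-- Second moment of a sum around `c`, in terms of covariances and means. -/
theorem gibbsExp_sum_sub_sq {ι : Type*} (A : Finset ι) (f : ι → GConf d → ℝ) (c : ℝ) :
    gibbsExp Φ Λ τ (fun σ => (∑ i ∈ A, f i σ - c) ^ 2) =
      ∑ i ∈ A, ∑ j ∈ A, (gibbsExp Φ Λ τ (fun σ => f i σ * f j σ) -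
        gibbsExp Φ Λ τ (f i) * gibbsExp Φ Λ τ (f j)) +
      (∑ i ∈ A, gibbsExp Φ Λ τ (f i) - c) ^ 2 := by
  have h1 : (fun σ => (∑ i ∈ A, f i σ - c) ^ 2) = fun σ =>
      (∑ i ∈ A, ∑ j ∈ A, f i σ * f j σ) + ((-2 * c) * (∑ i ∈ A, f i σ) + c ^ 2) := by
    funext σ
    rw [← Finset.sum_mul_sum]
    ring
  rw [h1, gibbsExp_add, gibbsExp_add, gibbsExp_const_mul, gibbsExp_const, gibbsExp_sum,
    gibbsExp_sum]
  simp only [gibbsExp_sum, Finset.sum_sub_distrib]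
  rw [← Finset.sum_mul_sum]
  ring

end

theorem localOn_gibbsExp {d : ℕ} (G : LatticeGas d) (Λ : Finset (ZLat d))
    {f : GConf d → ℝ} {S : Finset (ZLat d)} (hf : LocalOn f S) :
    LocalOn (fun τ => gibbsExp (gasPotH G) Λ τ f) ((nbhd Λ G.r ∪ S) \ Λ) := by
  intro τ τ' h
  have hov : ∀ s : ↥Λ → Bool, ∀ x ∈ nbhd Λ G.r ∪ S, override Λ s τ x = override Λ s τ' x := by
    intro s x hx
    by_cases hxΛ : x ∈ Λ
    · rw [override_of_mem _ _ hxΛ, override_of_mem _ _ hxΛ]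
    · rw [override_of_notMem _ _ hxΛ, override_of_notMem _ _ hxΛ]
      exact h x (Finset.mem_sdiff.2 ⟨hx, hxΛ⟩)
  have hh : ∀ s, hamil (gasPotH G) Λ (override Λ s τ) = hamil (gasPotH G) Λ (override Λ s τ') :=
    fun s => localOn_hamil G Λ _ _ fun x hx => hov s x (Finset.mem_union_left _ hx)
  have hff : ∀ s, f (override Λ s τ) = f (override Λ s τ') :=
    fun s => hf _ _ fun x hx => hov s x (Finset.mem_union_right _ hx)
  simp only [gibbsExp, partFun, hh, hff]

/-! ### Translations -/

theorem gasPotH_translate {d : ℕ} (G : LatticeGas d) (X : Finset (ZLat d)) (x : ZLat d)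
    (σ : GConf d) : gasPotH G (X.image (· + x)) σ = gasPotH G X fun y => σ (y + x) := by
  unfold gasPotH gasPot
  rw [Finset.card_image_of_injective _ (add_left_injective x)]
  split_ifs
  · exact Finset.sum_image (add_left_injective x).injOn
  · exact G.UtransInv X x σ

theorem hamil_translate {d : ℕ} (G : LatticeGas d) (Λ : Finset (ZLat d)) (x : ZLat d)
    (σ : GConf d) :
    hamil (gasPotH G) (Λ.image (· + x)) σ = hamil (gasPotH G) Λ fun y => σ (y + x) := by
  unfold hamil
  rw [← (Equiv.finsetCongr (Equiv.addRight x)).tsum_eq]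
  refine tsum_congr fun X => ?_
  have h : Equiv.finsetCongr (Equiv.addRight x) X = X.image (· + x) := by
    rw [Equiv.finsetCongr_apply, Finset.map_eq_image]
    rfl
  rw [h, ← Finset.image_inter _ _ (add_left_injective x), gasPotH_translate]
  simp only [Finset.image_nonempty]

theorem gibbsExp_translate {d : ℕ} (G : LatticeGas d) (Λ : Finset (ZLat d)) (x : ZLat d)
    (τ : GConf d) (f : GConf d → ℝ) :
    gibbsExp (gasPotH G) (Λ.image (· + x)) τ (fun σ => f fun y => σ (y + x)) =
      gibbsExp (gasPotH G) Λ (fun y => τ (y + x)) f := by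
  have hmem : ∀ a, a ∈ Λ ↔ a + x ∈ Λ.image (· + x) := fun a => by simp
  let e : ↥Λ ≃ ↥(Λ.image (· + x)) := (Equiv.addRight x).subtypeEquiv hmem
  let E : (↥(Λ.image (· + x)) → Bool) ≃ (↥Λ → Bool) := Equiv.arrowCongr e.symm (Equiv.refl Bool)
  have hov : ∀ s, (fun y => override (Λ.image (· + x)) s τ (y + x)) =
      override Λ (E s) fun y => τ (y + x) := by
    intro s
    funext y
    by_cases hy : y ∈ Λ
    · rw [override_of_mem _ _ hy, override_of_mem _ _ ((hmem y).1 hy)]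
      rfl
    · rw [override_of_notMem _ _ hy, override_of_notMem _ _ (fun h => hy ((hmem y).2 h))]
  unfold gibbsExp partFun
  congr 1
  · refine Fintype.sum_equiv E _ _ fun s => ?_
    rw [hamil_translate, hov]
    simp only [hov]
  · refine Fintype.sum_equiv E _ _ fun s => ?_
    rw [hamil_translate, hov]

/-! ### Regions -/

theorem mem_cube {d : ℕ} {ℓ : ℕ} {i x : ZLat d} :
    x ∈ cube ℓ i ↔ ∀ k, (ℓ : ℤ) * i k ≤ x k ∧ x k < (ℓ : ℤ) * i k + ℓ := by
  simp [cube, Fintype.mem_piFinset]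

theorem card_cube {d : ℕ} (ℓ : ℕ) (i : ZLat d) : (cube ℓ i).card = ℓ ^ d := by
  simp [cube, Fintype.card_piFinset]

/-- The cube of side `3ℓ` concentric with `Q_ℓ(t)`. -/
def tripleCube {d : ℕ} (ℓ : ℕ) (t : ZLat d) : Finset (ZLat d) :=
  Fintype.piFinset fun k => Finset.Ico ((ℓ : ℤ) * (t k - 1)) ((ℓ : ℤ) * (t k + 2))

theorem mem_tripleCube {d : ℕ} {ℓ : ℕ} {t x : ZLat d} :
    x ∈ tripleCube ℓ t ↔ ∀ k, (ℓ : ℤ) * (t k - 1) ≤ x k ∧ x k < (ℓ : ℤ) * (t k + 2) := by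
  simp [tripleCube, Fintype.mem_piFinset]

theorem card_tripleCube {d : ℕ} (ℓ : ℕ) (t : ZLat d) : (tripleCube ℓ t).card = (3 * ℓ) ^ d := by
  have : ∀ k, (Finset.Ico ((ℓ : ℤ) * (t k - 1)) ((ℓ : ℤ) * (t k + 2))).card = 3 * ℓ := by
    intro k
    rw [Int.card_Ico]
    have : (ℓ : ℤ) * (t k + 2) - ℓ * (t k - 1) = ((3 * ℓ : ℕ) : ℤ) := by push_cast; ring
    rw [this, Int.toNat_natCast]
  simp [tripleCube, Fintype.card_piFinset, this]

theorem cube_subset_tripleCube {d : ℕ} (ℓ : ℕ) (t : ZLat d) : cube ℓ t ⊆ tripleCube ℓ t := by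
  intro x hx
  rw [mem_tripleCube]
  intro k
  have := mem_cube.1 hx k
  constructor <;> nlinarith

/-- The triple cube is a union of cubes of side `ℓ0` as soon as `ℓ0` divides `ℓ`. -/
theorem exists_tripleCube_eq {d : ℕ} {ℓ0 ℓ : ℕ} (h0 : 0 < ℓ0) (h : ℓ0 ∣ ℓ) (t : ZLat d) :
    ∃ I, tripleCube ℓ t = cubesRegion ℓ0 I := by
  obtain ⟨n, rfl⟩ := h
  have h0' : (0 : ℤ) < ℓ0 := by exact_mod_cast h0
  refine ⟨Fintype.piFinset fun k => Finset.Ico ((n : ℤ) * (t k - 1)) ((n : ℤ) * (t k + 2)), ?_⟩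
  ext x
  simp only [mem_tripleCube, cubesRegion, Finset.mem_biUnion, Fintype.mem_piFinset,
    Finset.mem_Ico, mem_cube]
  push_cast
  constructor
  · intro hx
    refine ⟨fun k => x k / ℓ0, fun k => ⟨?_, ?_⟩, fun k => ⟨?_, ?_⟩⟩
    · rw [Int.le_ediv_iff_mul_le h0']
      linarith [(hx k).1]
    · rw [Int.ediv_lt_iff_lt_mul h0']
      linarith [(hx k).2]
    · exact Int.mul_ediv_self_le h0'.ne'
    · exact Int.lt_mul_ediv_self_add h0'
  · rintro ⟨i, hi, hx⟩ k
    obtain ⟨h1, h2⟩ := hi k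
    obtain ⟨h3, h4⟩ := hx k
    have h2' : i k + 1 ≤ (n : ℤ) * (t k + 2) := h2
    constructor
    · calc (ℓ0 : ℤ) * n * (t k - 1) = ℓ0 * (n * (t k - 1)) := by ring
        _ ≤ ℓ0 * i k := mul_le_mul_of_nonneg_left h1 h0'.le
        _ ≤ x k := h3
    · calc x k < ℓ0 * (i k + 1) := by linarith
        _ ≤ ℓ0 * (n * (t k + 2)) := mul_le_mul_of_nonneg_left h2' h0'.le
        _ = (ℓ0 : ℤ) * n * (t k + 2) := by ring

theorem le_supD_of_notMem_tripleCube {d : ℕ} {ℓ : ℕ} {t x y : ZLat d} (hx : x ∈ cube ℓ t)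
    (hy : y ∉ tripleCube ℓ t) : ℓ ≤ supD x y := by
  rw [mem_tripleCube] at hy
  push Not at hy
  obtain ⟨k, hk⟩ := hy
  refine le_trans ?_ (natAbs_sub_le_supD x y k)
  obtain ⟨h1, h2⟩ := mem_cube.1 hx k
  by_cases hc : (ℓ : ℤ) * (t k - 1) ≤ y k
  · have := hk hc
    rw [mul_add] at this
    omega
  · rw [mul_sub] at hc
    omega

theorem cube_disjoint_tripleCube {d : ℕ} {ℓ : ℕ} {s t : ZLat d} {k : Fin d}
    (h : 2 ≤ (s k - t k).natAbs) : Disjoint (cube ℓ s) (tripleCube ℓ t) := by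
  rw [Finset.disjoint_left]
  intro x hx hx'
  obtain ⟨h1, h2⟩ := mem_cube.1 hx k
  obtain ⟨h3, h4⟩ := mem_tripleCube.1 hx' k
  have hℓ : (0 : ℤ) < ℓ := by linarith
  have a1 : s k < t k + 2 := lt_of_mul_lt_mul_left (h1.trans_lt h4) hℓ.le
  have a2 : t k - 1 < s k + 1 := by
    refine lt_of_mul_lt_mul_left (h3.trans_lt ?_) hℓ.le
    linarith
  omega

/-! ### Consequences of strong mixing -/

theorem fDist_singleton {d : ℕ} (x y : ZLat d) : fDist {x} {y} = supD x y := by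
  have : {p : ZLat d × ZLat d | p.1 ∈ ({x} : Finset (ZLat d)) ∧ p.2 ∈ ({y} : Finset (ZLat d))} =
      {(x, y)} := by
    ext p
    simp [Prod.ext_iff]
  rw [fDist, this, Set.image_singleton, csInf_singleton]

theorem fDist_nonneg {d : ℕ} (A B : Finset (ZLat d)) : 0 ≤ fDist A B := by
  refine Real.sInf_nonneg ?_
  rintro _ ⟨p, -, rfl⟩
  positivity

theorem le_fDist_singleton {d : ℕ} {x : ZLat d} {A : Finset (ZLat d)} (hA : A.Nonempty) {L : ℝ}
    (h : ∀ z ∈ A, L ≤ supD x z) : L ≤ fDist {x} A := by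
  obtain ⟨z, hz⟩ := hA
  refine le_csInf ⟨_, (x, z), ⟨Finset.mem_singleton_self x, hz⟩, rfl⟩ ?_
  rintro _ ⟨⟨p1, p2⟩, ⟨h1, h2⟩, rfl⟩
  obtain rfl := Finset.mem_singleton.1 h1
  exact h p2 h2

theorem SM.covariance_occ_le {d : ℕ} {Φ : Finset (ZLat d) → GConf d → ℝ} {ℓ0 : ℕ} {b B : ℝ}
    (hb : 0 < b) (hB : 0 < B) (h : SM Φ ℓ0 b B) {I : Finset (ZLat d)} {x y : ZLat d}
    (hx : x ∈ cubesRegion ℓ0 I) (hy : y ∈ cubesRegion ℓ0 I) (τ : GConf d) :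
    gibbsExp Φ (cubesRegion ℓ0 I) τ (fun σ => occ x σ * occ y σ) -
      gibbsExp Φ (cubesRegion ℓ0 I) τ (occ x) * gibbsExp Φ (cubesRegion ℓ0 I) τ (occ y) ≤
      B * Real.exp (-b * supD x y) := by
  have hle : Real.exp (-b * supD x y) ≤ 1 := by
    rw [Real.exp_le_one_iff]
    have : 0 ≤ b * (supD x y : ℝ) := by positivity
    linarith
  have := h I (occ x) (occ y) {x} {y} (localOn_occ x) (localOn_occ y)
    (Finset.singleton_subset_iff.2 hx) (Finset.singleton_subset_iff.2 hy)
    (by simpa [fDist_singleton] using hle) τ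
  refine (le_abs_self _).trans (this.trans ?_)
  rw [fDist_singleton]
  simp only [Finset.card_singleton, Nat.cast_one, min_self, mul_one]
  refine mul_le_mul_of_nonneg_right ?_ (Real.exp_pos _).le
  calc B * supNorm (occ x) * supNorm (occ y) ≤ B * 1 * 1 := by
        have hx0 := supNorm_nonneg (occ x)
        have hx1 := supNorm_occ_le x
        have hy0 := supNorm_nonneg (occ y)
        have hy1 := supNorm_occ_le y
        gcongr
    _ = B := by ring

/-- The configuration equal to `σ` on `Λ` and to `τ` off `Λ`. -/
def patch {d : ℕ} (Λ : Finset (ZLat d)) (σ τ : GConf d) : GConf d :=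
  fun x => if x ∈ Λ then σ x else τ x

theorem patch_override {d : ℕ} (Λ : Finset (ZLat d)) (s : ↥Λ → Bool) (τ τ' : GConf d) :
    patch Λ (override Λ s τ) τ' = override Λ s τ' := by
  funext x
  by_cases hx : x ∈ Λ <;> simp [patch, override, hx]

/-- Effect on the mean occupation at `x` of a boundary condition change at a single site `y`. -/
theorem SM.abs_gibbsExp_occ_sub_le_of_flip {d : ℕ} {G : LatticeGas d} {ℓ0 : ℕ} {b B : ℝ}
    (hb : 0 < b) (hB : 0 < B) (h : SM (gasPotH G) ℓ0 b B) {I : Finset (ZLat d)} {x y : ZLat d}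
    (hx : x ∈ cubesRegion ℓ0 I) (hy : y ∉ cubesRegion ℓ0 I) {L : ℕ} (hL : L ≤ supD x y)
    {τ τ' : GConf d} (hτ : ∀ z, z ≠ y → τ' z = τ z) :
    |gibbsExp (gasPotH G) (cubesRegion ℓ0 I) τ' (occ x) -
      gibbsExp (gasPotH G) (cubesRegion ℓ0 I) τ (occ x)| ≤
      B * Real.exp (2 * flipBound G + b * G.r) * Real.exp (-b * L) := by
  set Λ := cubesRegion ℓ0 I with hΛ
  set Φ := gasPotH G with hΦ
  set K := flipBound G with hK
  let w : GConf d → ℝ := fun σ =>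
    Real.exp (hamil Φ Λ (patch Λ σ τ') - hamil Φ Λ (patch Λ σ τ))
  have hpatch : ∀ σ z, z ≠ y → patch Λ σ τ' z = patch Λ σ τ z := by
    intro σ z hz
    unfold patch
    rw [hτ z hz]
  have hwK : ∀ σ, |hamil Φ Λ (patch Λ σ τ') - hamil Φ Λ (patch Λ σ τ)| ≤ K := fun σ =>
    abs_hamil_sub_hamil_le G hy (hpatch σ)
  have hwle : ∀ σ, w σ ≤ Real.exp K := fun σ => Real.exp_le_exp.2 (abs_le.1 (hwK σ)).2
  have hlew : ∀ σ, Real.exp (-K) ≤ w σ := fun σ => Real.exp_le_exp.2 (abs_le.1 (hwK σ)).1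
  set S := Λ ∩ box y G.r with hS
  have hwlocal : LocalOn w S := by
    intro σ σ' hσ
    simp only [w]
    rw [hamil_sub_hamil G hy (hpatch σ), hamil_sub_hamil G hy (hpatch σ')]
    congr 1
    refine Finset.sum_congr rfl fun X hX => ?_
    have hagree : ∀ τ : GConf d, G.U X (patch Λ σ τ) = G.U X (patch Λ σ' τ) := by
      intro τ
      refine G.Ulocal X _ _ fun z hz => ?_
      unfold patch
      split_ifs with hzΛ
      · exact hσ z (Finset.mem_inter.2 ⟨hzΛ, Finset.mem_powerset.1 hX hz⟩)
      · rfl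
    rw [hagree, hagree]
  have hmin1 : (min ({x} : Finset (ZLat d)).card S.card : ℝ) ≤ 1 := by
    simp
  have hmin0 : 0 ≤ (min ({x} : Finset (ZLat d)).card S.card : ℝ) := by
    simp
  have hexp : ∀ D : ℝ, 0 ≤ D → Real.exp (-b * D) ≤ 1 := fun D hD => by
    rw [Real.exp_le_one_iff]
    have : 0 ≤ b * D := by positivity
    linarith
  have hdecay : (min ({x} : Finset (ZLat d)).card S.card : ℝ) * Real.exp (-b * fDist {x} S) ≤
      Real.exp (b * G.r) * Real.exp (-b * L) := by
    rcases S.eq_empty_or_nonempty with hSe | hSne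
    · simp only [hSe, Finset.card_empty, Nat.cast_zero, Finset.card_singleton, Nat.cast_one,
        zero_le_one, inf_of_le_right, zero_mul]
      positivity
    · have hdist : (L : ℝ) - G.r ≤ fDist {x} S := by
        refine le_fDist_singleton hSne fun z hz => ?_
        have h1 := mem_box.1 (Finset.mem_inter.1 hz).2
        have h2 := supD_triangle x z y
        rw [supD_comm z y] at h2
        have h3 : (L : ℝ) ≤ supD x z + G.r := by
          have : L ≤ supD x z + G.r := by omega
          exact_mod_cast this
        linarith
      calc (min ({x} : Finset (ZLat d)).card S.card : ℝ) * Real.exp (-b * fDist {x} S)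
          ≤ 1 * Real.exp (-b * fDist {x} S) :=
            mul_le_mul_of_nonneg_right hmin1 (Real.exp_pos _).le
        _ = Real.exp (-b * fDist {x} S) := one_mul _
        _ ≤ Real.exp (b * G.r + -b * L) := by
            refine Real.exp_le_exp.2 ?_
            nlinarith
        _ = Real.exp (b * G.r) * Real.exp (-b * L) := Real.exp_add _ _
  have hcov := h I (occ x) w {x} S (localOn_occ x) hwlocal
    (Finset.singleton_subset_iff.2 hx) Finset.inter_subset_left
    ((mul_le_mul hmin1 (hexp _ (fDist_nonneg _ _)) (Real.exp_pos _).le zero_le_one).trans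
      (by norm_num)) τ
  rw [← hΛ] at hcov
  have hsupw : supNorm w ≤ Real.exp K :=
    supNorm_le fun σ => by rw [abs_of_pos (Real.exp_pos _)]; exact hwle σ
  have hcov' : |gibbsExp Φ Λ τ (fun σ => occ x σ * w σ) -
      gibbsExp Φ Λ τ (occ x) * gibbsExp Φ Λ τ w| ≤
      B * Real.exp K * (Real.exp (b * G.r) * Real.exp (-b * L)) := by
    refine hcov.trans ?_
    rw [mul_assoc (B * supNorm (occ x) * supNorm w)]
    refine mul_le_mul ?_ hdecay (mul_nonneg hmin0 (Real.exp_pos _).le) (by positivity)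
    calc B * supNorm (occ x) * supNorm w ≤ B * 1 * Real.exp K := by
          have h0 := supNorm_nonneg (occ x)
          have h1 := supNorm_occ_le x
          have h2 := supNorm_nonneg w
          gcongr
      _ = B * Real.exp K := by ring
  have hZ := partFun_pos Φ Λ τ
  have hZ' := partFun_pos Φ Λ τ'
  have hreweight : ∀ f : GConf d → ℝ, (∀ s, f (override Λ s τ) = f (override Λ s τ')) →
      gibbsExp Φ Λ τ (fun σ => f σ * w σ) =
        gibbsExp Φ Λ τ' f * (partFun Φ Λ τ' / partFun Φ Λ τ) := by
    intro f hf
    unfold gibbsExp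
    rw [div_mul_div_cancel₀ hZ'.ne']
    congr 1
    refine Finset.sum_congr rfl fun s _ => ?_
    simp only [w, patch_override]
    rw [← hf s, Real.exp_sub]
    field_simp
  have hw1 : gibbsExp Φ Λ τ w = partFun Φ Λ τ' / partFun Φ Λ τ := by
    have := hreweight (fun _ => 1) fun _ => rfl
    simpa [gibbsExp_const] using this
  have hocc := hreweight (occ x) fun s => by
    unfold occ
    rw [override_of_mem _ _ hx, override_of_mem _ _ hx]
  have hratio : Real.exp (-K) ≤ partFun Φ Λ τ' / partFun Φ Λ τ := by
    rw [← hw1, ← gibbsExp_const Φ Λ τ (Real.exp (-K))]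
    exact gibbsExp_mono Φ Λ τ fun s => hlew _
  rw [hocc, hw1, ← sub_mul, abs_mul, abs_of_pos (div_pos hZ' hZ)] at hcov'
  have hfin : |gibbsExp Φ Λ τ' (occ x) - gibbsExp Φ Λ τ (occ x)| * Real.exp (-K) ≤
      B * Real.exp K * (Real.exp (b * G.r) * Real.exp (-b * L)) :=
    (mul_le_mul_of_nonneg_left hratio (abs_nonneg _)).trans hcov'
  calc |gibbsExp Φ Λ τ' (occ x) - gibbsExp Φ Λ τ (occ x)|
      = |gibbsExp Φ Λ τ' (occ x) - gibbsExp Φ Λ τ (occ x)| * Real.exp (-K) * Real.exp K := by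
        rw [mul_assoc, ← Real.exp_add]; simp
    _ ≤ B * Real.exp K * (Real.exp (b * G.r) * Real.exp (-b * L)) * Real.exp K :=
        mul_le_mul_of_nonneg_right hfin (Real.exp_pos _).le
    _ = B * Real.exp (2 * K + b * G.r) * Real.exp (-b * L) := by
        rw [two_mul, Real.exp_add, Real.exp_add]; ring

/-- Bound for the influence of the boundary condition on the mean occupation in the central
cube of a triple cube of side `3ℓ`. -/
def boundaryError {d : ℕ} (G : LatticeGas d) (b B : ℝ) (ℓ : ℕ) : ℝ :=
  ((3 * ℓ) ^ d * (2 * G.r + 1) ^ d : ℕ) *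
    (B * Real.exp (2 * flipBound G + b * G.r) * Real.exp (-b * ℓ))

theorem card_nbhd_le {d : ℕ} (Λ : Finset (ZLat d)) (r : ℕ) :
    (nbhd Λ r).card ≤ Λ.card * (2 * r + 1) ^ d := by
  refine Finset.card_biUnion_le.trans (le_of_eq ?_)
  simp [card_box]

theorem SM.abs_gibbsExp_occ_sub_le {d : ℕ} {G : LatticeGas d} {ℓ0 : ℕ} {b B : ℝ}
    (hℓ0 : 0 < ℓ0) (hb : 0 < b) (hB : 0 < B) (h : SM (gasPotH G) ℓ0 b B) {ℓ : ℕ} (hℓ : ℓ0 ∣ ℓ)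
    {t x : ZLat d} (hx : x ∈ cube ℓ t) (τ τ' : GConf d) :
    |gibbsExp (gasPotH G) (tripleCube ℓ t) τ (occ x) -
      gibbsExp (gasPotH G) (tripleCube ℓ t) τ' (occ x)| ≤ boundaryError G b B ℓ := by
  obtain ⟨I, hI⟩ := exists_tripleCube_eq hℓ0 hℓ t
  have hxt := cube_subset_tripleCube ℓ t hx
  set ε := B * Real.exp (2 * flipBound G + b * G.r) * Real.exp (-b * ℓ) with hε
  have key : ∀ Y : Finset (ZLat d), Disjoint Y (tripleCube ℓ t) →
      |gibbsExp (gasPotH G) (tripleCube ℓ t) (patch Y τ τ') (occ x) -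
        gibbsExp (gasPotH G) (tripleCube ℓ t) τ' (occ x)| ≤ Y.card * ε := by
    intro Y
    induction Y using Finset.induction_on with
    | empty =>
      intro _
      have : patch ∅ τ τ' = τ' := by funext z; simp [patch]
      simp [this]
    | insert y Y hy ih =>
      intro hdisj
      rw [Finset.disjoint_insert_left] at hdisj
      have hflip : |gibbsExp (gasPotH G) (tripleCube ℓ t) (patch (insert y Y) τ τ') (occ x) -
          gibbsExp (gasPotH G) (tripleCube ℓ t) (patch Y τ τ') (occ x)| ≤ ε := by
        have hd := le_supD_of_notMem_tripleCube hx hdisj.1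
        rw [hI] at hxt hdisj ⊢
        refine h.abs_gibbsExp_occ_sub_le_of_flip hb hB hxt hdisj.1 hd fun z hz => ?_
        simp [patch, Finset.mem_insert, hz]
      have := abs_sub_le (gibbsExp (gasPotH G) (tripleCube ℓ t) (patch (insert y Y) τ τ') (occ x))
        (gibbsExp (gasPotH G) (tripleCube ℓ t) (patch Y τ τ') (occ x))
        (gibbsExp (gasPotH G) (tripleCube ℓ t) τ' (occ x))
      rw [Finset.card_insert_of_notMem hy]
      push_cast
      linarith [ih hdisj.2]
  have hY := key (nbhd (tripleCube ℓ t) G.r \ tripleCube ℓ t) Finset.sdiff_disjoint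
  have heq : gibbsExp (gasPotH G) (tripleCube ℓ t)
      (patch (nbhd (tripleCube ℓ t) G.r \ tripleCube ℓ t) τ τ') (occ x) =
      gibbsExp (gasPotH G) (tripleCube ℓ t) τ (occ x) := by
    refine localOn_gibbsExp G (tripleCube ℓ t) (localOn_occ x) _ _ fun z hz => ?_
    have hz' : z ∈ nbhd (tripleCube ℓ t) G.r \ tripleCube ℓ t := by
      rw [Finset.mem_sdiff, Finset.mem_union, Finset.mem_singleton] at hz
      rw [Finset.mem_sdiff]
      refine ⟨hz.1.resolve_right ?_, hz.2⟩
      rintro rfl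
      exact hz.2 hxt
    simp only [patch, if_pos hz']
  rw [heq] at hY
  refine hY.trans ?_
  unfold boundaryError
  rw [← hε]
  refine mul_le_mul_of_nonneg_right ?_ (by positivity)
  rw [← card_tripleCube ℓ t]
  exact_mod_cast (Finset.card_le_card Finset.sdiff_subset).trans (card_nbhd_le _ _)

theorem tendsto_pow_mul_boundaryError {d : ℕ} (G : LatticeGas d) {b : ℝ} (hb : 0 < b) (B : ℝ) :
    Filter.Tendsto (fun ℓ : ℕ => (ℓ : ℝ) ^ d * boundaryError G b B ℓ) Filter.atTop (nhds 0) := by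
  have h1 : Filter.Tendsto (fun ℓ : ℕ => b * (ℓ : ℝ)) Filter.atTop Filter.atTop :=
    tendsto_natCast_atTop_atTop.const_mul_atTop hb
  have h2 := ((Real.tendsto_pow_mul_exp_neg_atTop_nhds_zero (2 * d)).comp h1).const_mul
    ((3 : ℝ) ^ d * (2 * G.r + 1) ^ d * (B * Real.exp (2 * flipBound G + b * G.r)) /
      b ^ (2 * d))
  rw [mul_zero] at h2
  refine h2.congr fun ℓ => ?_
  simp only [Function.comp, boundaryError]
  push_cast
  rw [mul_pow b, mul_pow (3 : ℝ), neg_mul]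
  field_simp
  ring

theorem tendsto_boundaryError {d : ℕ} (G : LatticeGas d) {b : ℝ} (hb : 0 < b) {B : ℝ}
    (hB : 0 < B) :
    Filter.Tendsto (fun ℓ : ℕ => boundaryError G b B ℓ) Filter.atTop (nhds 0) := by
  have hnn : ∀ ℓ, 0 ≤ boundaryError G b B ℓ := fun ℓ => by unfold boundaryError; positivity
  refine squeeze_zero' (Filter.Eventually.of_forall hnn) ?_
    (tendsto_pow_mul_boundaryError G hb B)
  filter_upwards [Filter.eventually_ge_atTop 1] with ℓ hℓ
  exact le_mul_of_one_le_left (hnn ℓ) (one_le_pow₀ (by exact_mod_cast hℓ))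

/-! ### Infinite volume consequences -/

theorem abs_integral_sub_le_of_forall {α : Type*} [MeasurableSpace α] (μ : Measure α)
    [IsProbabilityMeasure μ] {f : α → ℝ} (hf : Integrable f μ) {c e : ℝ}
    (h : ∀ a, |f a - c| ≤ e) : |∫ a, f a ∂μ - c| ≤ e := by
  have h1 : ∫ a, f a ∂μ - c = ∫ a, (f a - c) ∂μ := by
    rw [integral_sub hf (integrable_const c)]
    simp
  rw [h1, ← Real.norm_eq_abs]
  refine (norm_integral_le_of_norm_le_const (C := e) (Filter.Eventually.of_forall h)).trans ?_
  simp

section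

variable {d : ℕ} {G : LatticeGas d} {ℓ0 : ℕ} {b B : ℝ}
  {μ : Measure (GConf d)} [IsProbabilityMeasure μ]

/-- The density is the same at all sites. -/
theorem integral_occ_eq_rho (hℓ0 : 0 < ℓ0) (hb : 0 < b) (hB : 0 < B)
    (hSM : SM (gasPotH G) ℓ0 b B) (hμ : IsGibbs (gasPotH G) μ) (x : ZLat d) :
    ∫ η, occ x η ∂μ = rho μ := by
  have key : ∀ n : ℕ, 1 ≤ n → |∫ η, occ x η ∂μ - rho μ| ≤ 2 * boundaryError G b B (ℓ0 * n) := by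
    intro n hn
    set ℓ := ℓ0 * n with hℓ
    have hℓpos : (0 : ℤ) < ℓ := by
      have : 0 < ℓ := Nat.mul_pos hℓ0 hn
      exact_mod_cast this
    have h0 : (0 : ZLat d) ∈ cube ℓ 0 := mem_cube.2 fun k => by simpa using hℓpos
    set Λ := tripleCube ℓ (0 : ZLat d) with hΛ
    set c := gibbsExp (gasPotH G) Λ (fun _ => false) (occ 0) with hc
    have hosc : ∀ τ, |gibbsExp (gasPotH G) Λ τ (occ 0) - c| ≤ boundaryError G b B ℓ := fun τ =>
      hSM.abs_gibbsExp_occ_sub_le hℓ0 hb hB (Dvd.intro _ rfl) h0 τ _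
    have e1 : |rho μ - c| ≤ boundaryError G b B ℓ := by
      unfold rho
      rw [← hμ Λ (occ 0) {0} (localOn_occ 0)]
      exact abs_integral_sub_le_of_forall μ
        ((localOn_gibbsExp G Λ (localOn_occ 0)).integrable μ) hosc
    have hshift : (fun σ : GConf d => occ 0 fun y => σ (y + x)) = occ x := by
      funext σ
      simp [occ]
    have e2 : |∫ η, occ x η ∂μ - c| ≤ boundaryError G b B ℓ := by
      rw [← hμ (Λ.image (· + x)) (occ x) {x} (localOn_occ x)]
      refine abs_integral_sub_le_of_forall μ
        ((localOn_gibbsExp G _ (localOn_occ x)).integrable μ) fun τ => ?_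
      rw [← hshift, gibbsExp_translate]
      exact hosc _
    have := abs_sub_le (∫ η, occ x η ∂μ) c (rho μ)
    rw [abs_sub_comm c] at this
    linarith
  have hlim : Filter.Tendsto (fun n : ℕ => 2 * boundaryError G b B (ℓ0 * n)) Filter.atTop
      (nhds 0) := by
    have := ((tendsto_boundaryError G hb hB).comp
      (Filter.tendsto_id.const_mul_atTop' hℓ0)).const_mul 2
    simpa [Function.comp_def] using this
  have hle : |∫ η, occ x η ∂μ - rho μ| ≤ 0 := by
    refine ge_of_tendsto hlim ?_
    filter_upwards [Filter.eventually_ge_atTop 1] with n hn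
    exact key n hn
  have := abs_nonpos_iff.1 hle
  linarith

theorem abs_gibbsExp_occ_sub_rho_le (hℓ0 : 0 < ℓ0) (hb : 0 < b) (hB : 0 < B)
    (hSM : SM (gasPotH G) ℓ0 b B) (hμ : IsGibbs (gasPotH G) μ) {ℓ : ℕ} (hℓ : ℓ0 ∣ ℓ)
    {t x : ZLat d} (hx : x ∈ cube ℓ t) (τ : GConf d) :
    |gibbsExp (gasPotH G) (tripleCube ℓ t) τ (occ x) - rho μ| ≤ boundaryError G b B ℓ := by
  rw [← integral_occ_eq_rho hℓ0 hb hB hSM hμ x,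
    ← hμ (tripleCube ℓ t) (occ x) {x} (localOn_occ x), abs_sub_comm]
  exact abs_integral_sub_le_of_forall μ
    ((localOn_gibbsExp G _ (localOn_occ x)).integrable μ)
    fun τ' => hSM.abs_gibbsExp_occ_sub_le hℓ0 hb hB hℓ hx τ' τ

theorem summable_exp_neg_mul_natAbs {c : ℝ} (hc : 0 < c) :
    Summable fun z : ℤ => Real.exp (-c * (z.natAbs : ℝ)) := by
  have h : Summable fun n : ℕ => Real.exp (-c * (n : ℝ)) := by
    have := summable_geometric_of_lt_one (Real.exp_pos (-c)).le
      (Real.exp_lt_one_iff.2 (by linarith))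
    refine this.congr fun n => ?_
    rw [← Real.exp_nat_mul]
    ring_nf
  exact Summable.of_nat_of_neg (by simpa using h) (by simpa using h)

/-- The sum over `ℤ` of `exp (-(b / d) |z|)`. -/
def expSum (d : ℕ) (b : ℝ) : ℝ := ∑' z : ℤ, Real.exp (-(b / d) * (z.natAbs : ℝ))

theorem sum_cube_exp_le (hd : 0 < d) (hb : 0 < b) (ℓ : ℕ) (t x : ZLat d) :
    ∑ y ∈ cube ℓ t, Real.exp (-b * supD x y) ≤ expSum d b ^ d := by
  have hd' : (0 : ℝ) < d := by exact_mod_cast hd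
  have hc : 0 < b / d := div_pos hb hd'
  have hterm : ∀ y : ZLat d, Real.exp (-b * supD x y) ≤
      ∏ k, Real.exp (-(b / d) * ((x k - y k).natAbs : ℝ)) := by
    intro y
    rw [← Real.exp_sum, ← Finset.mul_sum]
    refine Real.exp_le_exp.2 ?_
    have h1 : ∑ k, ((x k - y k).natAbs : ℝ) ≤ d * supD x y := by
      calc ∑ k, ((x k - y k).natAbs : ℝ) ≤ ∑ _k : Fin d, (supD x y : ℝ) :=
            Finset.sum_le_sum fun k _ => by exact_mod_cast natAbs_sub_le_supD x y k
        _ = d * supD x y := by simp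
    have h2 : b / d * ∑ k, ((x k - y k).natAbs : ℝ) ≤ b * supD x y := by
      calc b / d * ∑ k, ((x k - y k).natAbs : ℝ) ≤ b / d * (d * supD x y) :=
            mul_le_mul_of_nonneg_left h1 hc.le
        _ = b * supD x y := by field_simp
    linarith
  calc ∑ y ∈ cube ℓ t, Real.exp (-b * supD x y)
      ≤ ∑ y ∈ cube ℓ t, ∏ k, Real.exp (-(b / d) * ((x k - y k).natAbs : ℝ)) :=
        Finset.sum_le_sum fun y _ => hterm y
    _ = ∏ k, ∑ z ∈ Finset.Ico ((ℓ : ℤ) * t k) ((ℓ : ℤ) * t k + ℓ),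
          Real.exp (-(b / d) * ((x k - z).natAbs : ℝ)) := by
        rw [Finset.prod_univ_sum]
        rfl
    _ ≤ ∏ _k : Fin d, expSum d b := by
        refine Finset.prod_le_prod (fun k _ => Finset.sum_nonneg fun z _ => (Real.exp_pos _).le)
          fun k _ => ?_
        have hs := summable_exp_neg_mul_natAbs hc
        have hs' := (Equiv.subLeft (x k)).summable_iff.2 hs
        have he := (Equiv.subLeft (x k)).tsum_eq
          fun z : ℤ => Real.exp (-(b / d) * (z.natAbs : ℝ))
        unfold expSum
        rw [← he]
        exact hs'.sum_le_tsum _ fun z _ => (Real.exp_pos _).le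
    _ = expSum d b ^ d := by simp

/-- Second moment of the particle number of a cube around its equilibrium mean, uniformly in the
boundary condition outside the triple cube. -/
theorem gibbsExp_sq_le (hd : 0 < d) (hℓ0 : 0 < ℓ0) (hb : 0 < b) (hB : 0 < B)
    (hSM : SM (gasPotH G) ℓ0 b B) (hμ : IsGibbs (gasPotH G) μ) {ℓ : ℕ} (hℓ : ℓ0 ∣ ℓ)
    (t : ZLat d) (τ : GConf d) :
    gibbsExp (gasPotH G) (tripleCube ℓ t) τ
      (fun σ => (∑ x ∈ cube ℓ t, occ x σ - rho μ * (ℓ : ℝ) ^ d) ^ 2) ≤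
      B * expSum d b ^ d * (ℓ : ℝ) ^ d + ((ℓ : ℝ) ^ d * boundaryError G b B ℓ) ^ 2 := by
  rw [gibbsExp_sum_sub_sq]
  obtain ⟨I, hI⟩ := exists_tripleCube_eq hℓ0 hℓ t
  have hsub := cube_subset_tripleCube ℓ t
  refine add_le_add ?_ ?_
  · calc _ ≤ ∑ x ∈ cube ℓ t, ∑ y ∈ cube ℓ t, B * Real.exp (-b * supD x y) := by
          refine Finset.sum_le_sum fun x hx => Finset.sum_le_sum fun y hy => ?_
          rw [hI] at hsub ⊢
          exact hSM.covariance_occ_le hb hB (hsub hx) (hsub hy) τ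
      _ ≤ ∑ x ∈ cube ℓ t, B * expSum d b ^ d := by
          refine Finset.sum_le_sum fun x _ => ?_
          rw [← Finset.mul_sum]
          exact mul_le_mul_of_nonneg_left (sum_cube_exp_le hd hb ℓ t x) hB.le
      _ = B * expSum d b ^ d * (ℓ : ℝ) ^ d := by
          rw [Finset.sum_const, card_cube, nsmul_eq_mul]
          push_cast
          ring
  · rw [sq_le_sq]
    refine le_trans ?_ (le_abs_self _)
    have h1 : ∑ x ∈ cube ℓ t, gibbsExp (gasPotH G) (tripleCube ℓ t) τ (occ x) -
        rho μ * (ℓ : ℝ) ^ d =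
        ∑ x ∈ cube ℓ t, (gibbsExp (gasPotH G) (tripleCube ℓ t) τ (occ x) - rho μ) := by
      rw [Finset.sum_sub_distrib, Finset.sum_const, card_cube, nsmul_eq_mul]
      push_cast
      ring
    rw [h1]
    refine (Finset.abs_sum_le_sum_abs _ _).trans ((Finset.sum_le_sum fun x hx =>
      abs_gibbsExp_occ_sub_rho_le hℓ0 hb hB hSM hμ hℓ hx τ).trans (le_of_eq ?_))
    rw [Finset.sum_const, card_cube, nsmul_eq_mul]
    push_cast
    rfl

/-- Indicator that the particle number in `Q_ℓ(t)` deviates by more than `T` from `m`. -/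
def devInd (ℓ : ℕ) (m T : ℝ) (t : ZLat d) (σ : GConf d) : ℝ :=
  if T < |∑ x ∈ cube ℓ t, occ x σ - m| then 1 else 0

theorem devInd_nonneg (ℓ : ℕ) (m T : ℝ) (t : ZLat d) (σ : GConf d) : 0 ≤ devInd ℓ m T t σ := by
  unfold devInd; split_ifs <;> norm_num

theorem localOn_devInd (ℓ : ℕ) (m T : ℝ) (t : ZLat d) :
    LocalOn (devInd ℓ m T t) (cube ℓ t) := by
  intro σ τ h
  unfold devInd
  rw [Finset.sum_congr rfl fun x hx => localOn_occ x σ τ fun y hy => by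
    rw [Finset.mem_singleton.1 hy]; exact h x hx]

theorem localOn_prod_devInd (ℓ : ℕ) (m T : ℝ) (A : Finset (ZLat d)) :
    LocalOn (fun σ => ∏ t ∈ A, devInd ℓ m T t σ) (A.biUnion (cube ℓ)) := by
  intro σ τ h
  refine Finset.prod_congr rfl fun t ht => localOn_devInd ℓ m T t σ τ fun x hx => h x ?_
  exact Finset.mem_biUnion.2 ⟨t, ht, hx⟩

/-- Uniform bound for the conditional probability that a block is bad. -/
theorem gibbsExp_devInd_le (hd : 0 < d) (hℓ0 : 0 < ℓ0) (hb : 0 < b) (hB : 0 < B)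
    (hSM : SM (gasPotH G) ℓ0 b B) (hμ : IsGibbs (gasPotH G) μ) {ℓ : ℕ} (hℓ : ℓ0 ∣ ℓ)
    {T : ℝ} (hT : 0 < T) (t : ZLat d) (τ : GConf d) :
    gibbsExp (gasPotH G) (tripleCube ℓ t) τ (devInd ℓ (rho μ * (ℓ : ℝ) ^ d) T t) ≤
      (T ^ 2)⁻¹ * (B * expSum d b ^ d * (ℓ : ℝ) ^ d +
        ((ℓ : ℝ) ^ d * boundaryError G b B ℓ) ^ 2) := by
  refine le_trans ?_ (mul_le_mul_of_nonneg_left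
    (gibbsExp_sq_le hd hℓ0 hb hB hSM hμ hℓ t τ) (by positivity))
  rw [← gibbsExp_const_mul]
  refine gibbsExp_mono _ _ _ fun s => ?_
  unfold devInd
  split_ifs with h
  · rw [inv_mul_eq_div, one_le_div (by positivity), ← sq_abs (_ - _)]
    exact pow_le_pow_left₀ hT.le h.le 2
  · positivity

/-- Factorization over separated sites, by successive conditioning. -/
theorem integral_prod_devInd_le (hμ : IsGibbs (gasPotH G) μ) {ℓ : ℕ} {m T p : ℝ} (hp : 0 ≤ p)
    (hbound : ∀ t τ, gibbsExp (gasPotH G) (tripleCube ℓ t) τ (devInd ℓ m T t) ≤ p)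
    (A : Finset (ZLat d))
    (hA : ∀ s ∈ A, ∀ t ∈ A, s ≠ t → ∃ k, 2 ≤ (s k - t k).natAbs) :
    ∫ η, ∏ t ∈ A, devInd ℓ m T t η ∂μ ≤ p ^ A.card := by
  induction A using Finset.induction_on with
  | empty => simp
  | insert t A ht ih =>
    have ih' := ih fun s hs u hu =>
      hA s (Finset.mem_insert_of_mem hs) u (Finset.mem_insert_of_mem hu)
    have hnn : ∀ σ, 0 ≤ ∏ s ∈ A, devInd ℓ m T s σ := fun σ =>
      Finset.prod_nonneg fun s _ => devInd_nonneg ℓ m T s σ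
    rw [← hμ (tripleCube ℓ t) _ _ (localOn_prod_devInd ℓ m T (insert t A))]
    have hle : ∀ τ, gibbsExp (gasPotH G) (tripleCube ℓ t) τ
        (fun σ => ∏ s ∈ insert t A, devInd ℓ m T s σ) ≤ p * ∏ s ∈ A, devInd ℓ m T s τ := by
      intro τ
      have hfreeze : ∀ s : ↥(tripleCube ℓ t) → Bool,
          ∏ u ∈ A, devInd ℓ m T u (override (tripleCube ℓ t) s τ) =
            ∏ u ∈ A, devInd ℓ m T u τ := by
        intro s
        refine localOn_prod_devInd ℓ m T A _ _ fun x hx => override_of_notMem _ _ ?_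
        obtain ⟨u, hu, hxu⟩ := Finset.mem_biUnion.1 hx
        have hut : u ≠ t := by rintro rfl; exact ht hu
        obtain ⟨k, hk⟩ := hA u (Finset.mem_insert_of_mem hu) t (Finset.mem_insert_self t A) hut
        exact Finset.disjoint_left.1 (cube_disjoint_tripleCube hk) hxu
      calc gibbsExp (gasPotH G) (tripleCube ℓ t) τ
            (fun σ => ∏ s ∈ insert t A, devInd ℓ m T s σ)
          ≤ gibbsExp (gasPotH G) (tripleCube ℓ t) τ
            (fun σ => (∏ s ∈ A, devInd ℓ m T s τ) * devInd ℓ m T t σ) := by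
            refine gibbsExp_mono _ _ _ fun s => ?_
            rw [Finset.prod_insert ht, hfreeze, mul_comm]
        _ = (∏ s ∈ A, devInd ℓ m T s τ) *
            gibbsExp (gasPotH G) (tripleCube ℓ t) τ (devInd ℓ m T t) := gibbsExp_const_mul _ _ _ _ _
        _ ≤ (∏ s ∈ A, devInd ℓ m T s τ) * p := mul_le_mul_of_nonneg_left (hbound t τ) (hnn τ)
        _ = p * ∏ s ∈ A, devInd ℓ m T s τ := mul_comm _ _
    calc _ ≤ ∫ τ, p * ∏ s ∈ A, devInd ℓ m T s τ ∂μ := by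
          refine integral_mono_of_nonneg (Filter.Eventually.of_forall fun τ => ?_)
            (((localOn_prod_devInd ℓ m T A).integrable μ).const_mul p)
            (Filter.Eventually.of_forall hle)
          exact gibbsExp_nonneg _ _ _ fun σ =>
            Finset.prod_nonneg fun s _ => devInd_nonneg ℓ m T s σ
      _ = p * ∫ τ, ∏ s ∈ A, devInd ℓ m T s τ ∂μ := integral_const_mul _ _
      _ ≤ p * p ^ A.card := mul_le_mul_of_nonneg_left ih' hp
      _ = p ^ (insert t A).card := by rw [Finset.card_insert_of_notMem ht, pow_succ']

theorem measure_forall_dev_le_of_separated (hμ : IsGibbs (gasPotH G) μ) {ℓ : ℕ} {m T p : ℝ}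
    (hp : 0 ≤ p)
    (hbound : ∀ t τ, gibbsExp (gasPotH G) (tripleCube ℓ t) τ (devInd ℓ m T t) ≤ p)
    (A : Finset (ZLat d))
    (hA : ∀ s ∈ A, ∀ t ∈ A, s ≠ t → ∃ k, 2 ≤ (s k - t k).natAbs) :
    μ {η | ∀ t ∈ A, T < |∑ x ∈ cube ℓ t, occ x η - m|} ≤ ENNReal.ofReal (p ^ A.card) := by
  set E := {η : GConf d | ∀ t ∈ A, T < |∑ x ∈ cube ℓ t, occ x η - m|} with hE
  have hprod : (fun η => ∏ t ∈ A, devInd ℓ m T t η) = E.indicator 1 := by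
    funext η
    by_cases h : η ∈ E
    · rw [Set.indicator_of_mem h, Pi.one_apply]
      exact Finset.prod_eq_one fun t ht => if_pos (h t ht)
    · rw [Set.indicator_of_notMem h]
      simp only [hE, Set.mem_ofPred_eq, not_forall] at h
      obtain ⟨t, ht, hn⟩ := h
      exact Finset.prod_eq_zero ht (if_neg hn)
  have hmeas : MeasurableSet E := by
    have h1 := (localOn_prod_devInd ℓ m T A).measurable
    rw [hprod] at h1
    exact (measurable_indicator_const_iff (1 : ℝ)).1 h1
  have h2 := integral_prod_devInd_le hμ hp hbound A hA
  rw [hprod, integral_indicator_one hmeas] at h2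
  rw [← ofReal_measureReal]
  exact ENNReal.ofReal_le_ofReal h2

/-- The residue class of a site modulo `3`. -/
def residue (t : ZLat d) : Fin d → ZMod 3 := fun k => (t k : ZMod 3)

theorem exists_two_le_of_residue_eq {s t : ZLat d} (hst : s ≠ t) (h : residue s = residue t) :
    ∃ k, 2 ≤ (s k - t k).natAbs := by
  obtain ⟨k, hk⟩ := Function.ne_iff.1 hst
  refine ⟨k, ?_⟩
  have h1 : ((s k : ℤ) : ZMod 3) = (t k : ZMod 3) := congrFun h k
  rw [ZMod.intCast_eq_intCast_iff_dvd_sub] at h1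
  push_cast at h1
  omega

theorem exists_large_residue_class (A : Finset (ZLat d)) :
    ∃ c, A.card ≤ 3 ^ d * (A.filter fun t => residue t = c).card := by
  obtain ⟨c, -, hc⟩ := Finset.exists_max_image (Finset.univ : Finset (Fin d → ZMod 3))
    (fun c => (A.filter fun t => residue t = c).card) Finset.univ_nonempty
  refine ⟨c, ?_⟩
  calc A.card = ∑ c' : Fin d → ZMod 3, (A.filter fun t => residue t = c').card :=
        Finset.card_eq_sum_card_fiberwise fun _ _ => Finset.mem_coe.2 (Finset.mem_univ _)
    _ ≤ ∑ _c' : Fin d → ZMod 3, (A.filter fun t => residue t = c).card :=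
        Finset.sum_le_sum fun c' hc' => hc c' hc'
    _ = 3 ^ d * (A.filter fun t => residue t = c).card := by
        simp [ZMod.card]

theorem measure_forall_dev_le (hμ : IsGibbs (gasPotH G) μ) {ℓ : ℕ} {m T q : ℝ}
    (hq : 0 ≤ q) (hq1 : q ≤ 1)
    (hbound : ∀ t τ, gibbsExp (gasPotH G) (tripleCube ℓ t) τ (devInd ℓ m T t) ≤ q ^ 3 ^ d)
    (A : Finset (ZLat d)) :
    μ {η | ∀ t ∈ A, T < |∑ x ∈ cube ℓ t, occ x η - m|} ≤ ENNReal.ofReal (q ^ A.card) := by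
  obtain ⟨c, hc⟩ := exists_large_residue_class A
  calc μ {η | ∀ t ∈ A, T < |∑ x ∈ cube ℓ t, occ x η - m|}
      ≤ μ {η | ∀ t ∈ A.filter fun t => residue t = c, T < |∑ x ∈ cube ℓ t, occ x η - m|} :=
        measure_mono fun η hη t ht => hη t (Finset.mem_of_mem_filter t ht)
    _ ≤ ENNReal.ofReal ((q ^ 3 ^ d) ^ (A.filter fun t => residue t = c).card) := by
        refine measure_forall_dev_le_of_separated hμ (by positivity) hbound _
          fun s hs t ht hst => exists_two_le_of_residue_eq hst ?_
        rw [(Finset.mem_filter.1 hs).2, (Finset.mem_filter.1 ht).2]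
    _ ≤ ENNReal.ofReal (q ^ A.card) := by
        rw [← pow_mul]
        exact ENNReal.ofReal_le_ofReal (pow_le_pow_of_le_one hq hq1 hc)

end

/-- The uniform tail bound tends to zero. -/
theorem tendsto_tailBound {d : ℕ} (hd : 0 < d) (G : LatticeGas d) {b : ℝ} (hb : 0 < b) (B C : ℝ)
    {δ : ℝ} (hδ : δ < 1 / 6) :
    Filter.Tendsto (fun ℓ : ℕ => ((((ℓ : ℝ) ^ ((2 / 3 - δ) * d)) ^ 2)⁻¹ *
      (C * (ℓ : ℝ) ^ d + ((ℓ : ℝ) ^ d * boundaryError G b B ℓ) ^ 2)))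
      Filter.atTop (nhds 0) := by
  have hd' : (0 : ℝ) < d := by exact_mod_cast hd
  have hneg : ∀ y : ℝ, 0 < y →
      Filter.Tendsto (fun ℓ : ℕ => (ℓ : ℝ) ^ (-y)) Filter.atTop (nhds 0) := fun y hy =>
    (tendsto_rpow_neg_atTop hy).comp tendsto_natCast_atTop_atTop
  have h1 := (hneg ((1 / 3 - 2 * δ) * d) (mul_pos (by linarith) hd')).const_mul C
  have h2 := (hneg (2 * ((2 / 3 - δ) * d)) (mul_pos two_pos (mul_pos (by linarith) hd'))).mul
    ((tendsto_pow_mul_boundaryError G hb B).pow 2)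
  have h3 := h1.add h2
  simp only [mul_zero, zero_mul, add_zero] at h3
  refine h3.congr' ?_
  filter_upwards [Filter.eventually_gt_atTop 0] with ℓ hℓ
  have hℓ' : (0 : ℝ) < ℓ := by exact_mod_cast hℓ
  have e1 : (((ℓ : ℝ) ^ ((2 / 3 - δ) * d)) ^ 2)⁻¹ = (ℓ : ℝ) ^ (-(2 * ((2 / 3 - δ) * d))) := by
    rw [← Real.rpow_natCast, ← Real.rpow_mul hℓ'.le, ← Real.rpow_neg hℓ'.le]
    congr 1
    push_cast
    ring
  have e2 : (ℓ : ℝ) ^ (-((1 / 3 - 2 * δ) * d)) =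
      (ℓ : ℝ) ^ (-(2 * ((2 / 3 - δ) * d))) * (ℓ : ℝ) ^ d := by
    rw [← Real.rpow_natCast (ℓ : ℝ) d, ← Real.rpow_add hℓ']
    congr 1
    ring
  rw [e1, e2]
  ring

/-! ### The block configurations -/

theorem cube_one {d : ℕ} (t : ZLat d) : cube 1 t = {t} := by
  ext x
  rw [mem_cube, Finset.mem_singleton, funext_iff]
  refine forall_congr' fun k => ?_
  push_cast
  omega

theorem badInd_one_eq_true_iff {d : ℕ} (δ : ℝ) (μ : Measure (GConf d)) (ℓ : ℕ)
    (m : ZLat d → ℝ) (t : ZLat d) :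
    badInd 1 δ μ ℓ m t = true ↔
      (ℓ : ℝ) ^ ((2 / 3 - δ) * d) / Real.sqrt ((ℓ : ℝ) ^ d * chi μ) < |m t| := by
  simp [badInd, goodSet, cube_one]

theorem badInd_eq_true_iff_notMem {d : ℕ} (c : ℕ) (δ : ℝ) (μ : Measure (GConf d)) (ℓ : ℕ)
    (m : ZLat d → ℝ) (t : ZLat d) :
    badInd c δ μ ℓ m t = true ↔ t ∉ goodSet c δ μ ℓ m := by
  simp [badInd]

theorem measurableSet_badInd_one {d : ℕ} (δ : ℝ) (μ : Measure (GConf d)) (ℓ : ℕ)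
    {S : Set (ZLat d)} {t : ZLat d} (ht : t ∈ S) :
    MeasurableSet[cylR S] {m : ZLat d → ℝ | badInd 1 δ μ ℓ m t = true} := by
  simp only [badInd_one_eq_true_iff]
  refine ⟨{f : S → ℝ | (ℓ : ℝ) ^ ((2 / 3 - δ) * d) / Real.sqrt ((ℓ : ℝ) ^ d * chi μ) <
    |f ⟨t, ht⟩|}, ?_, rfl⟩
  exact measurableSet_lt measurable_const (measurable_pi_apply _).abs

theorem measurable_Mblk {d : ℕ} (μ : Measure (GConf d)) (ℓ : ℕ) :
    Measurable fun (η : GConf d) i => Mblk μ ℓ i η := by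
  refine measurable_pi_lambda _ fun i => ?_
  unfold Mblk
  exact ((Finset.measurable_sum _ fun x _ => (localOn_occ x).measurable).sub_const _).div_const _

theorem dev_of_badInd_one {d : ℕ} {δ : ℝ} {μ : Measure (GConf d)} {ℓ : ℕ} {η : GConf d}
    {t : ZLat d} (h : badInd 1 δ μ ℓ (fun i => Mblk μ ℓ i η) t = true) :
    (ℓ : ℝ) ^ ((2 / 3 - δ) * d) < |∑ x ∈ cube ℓ t, occ x η - rho μ * (ℓ : ℝ) ^ d| := by
  rw [badInd_one_eq_true_iff, Mblk, abs_div, abs_of_nonneg (Real.sqrt_nonneg _)] at h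
  by_contra! hcon
  exact absurd h (not_lt.2 (div_le_div_of_nonneg_right hcon (Real.sqrt_nonneg _)))

theorem nu_forall_badInd_one_le {d : ℕ} {δ : ℝ} {μ : Measure (GConf d)} {ℓ : ℕ} {q : ℝ}
    (h : ∀ A : Finset (ZLat d), μ {η | ∀ t ∈ A, (ℓ : ℝ) ^ ((2 / 3 - δ) * d) <
      |∑ x ∈ cube ℓ t, occ x η - rho μ * (ℓ : ℝ) ^ d|} ≤ ENNReal.ofReal (q ^ A.card))
    (A : Finset (ZLat d)) :
    nu μ ℓ {m | ∀ t ∈ A, badInd 1 δ μ ℓ m t = true} ≤ ENNReal.ofReal (q ^ A.card) := by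
  have hmeas : MeasurableSet {m : ZLat d → ℝ | ∀ t ∈ A, badInd 1 δ μ ℓ m t = true} := by
    simp only [badInd_one_eq_true_iff, Set.ofPred_forall]
    exact MeasurableSet.iInter fun t => MeasurableSet.iInter fun _ =>
      measurableSet_lt measurable_const (measurable_pi_apply _).abs
  rw [nu, Measure.map_apply (measurable_Mblk μ ℓ) hmeas]
  refine (measure_mono ?_).trans (h A)
  intro η hη t ht
  have hη' : ∀ t ∈ A, badInd 1 δ μ ℓ (fun i => Mblk μ ℓ i η) t = true := hη
  exact dev_of_badInd_one (hη' t ht)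

theorem mem_blocksNear_one {d : ℕ} {Γ γ : ℕ → ℝ} {k : ℕ} {S : Set (ZLat d)} {t y : ZLat d}
    (ht : t ∈ S) (hy : (D1 t y : ℝ) ≤ theta Γ γ k) : y ∈ blocksNear 1 Γ γ k S := by
  refine ⟨y, ⟨t, ht, le_trans ?_ hy⟩, by simp [cube_one]⟩
  exact_mod_cast supD_le_D1 t y

/-- almost-sure gentle disintegration of the renormalized lattice. For
a lattice gas potential satisfying SM(ℓ0,b,B), `δ ∈ (0,1/6)` and the explicit scales
`Γ, γ` (for a suitable `β ≥ 9`), for every sufficiently large `ℓ` multiple of `ℓ0`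
there is a measurable set of block configurations of full `ν^{(ℓ)}`-measure such
that: (i) each of its elements admits a gentle disintegration of the ℘-lattice with
respect to its good sites; (ii) the events `{n : t ∈ B_k(n)}` and `{n : X ∈ 𝒢_k(n)}`
are measurable with respect to the block variables within ℘-distance `θ_k` of `t`,
resp. of `X`. -/
theorem stmt15 {d : ℕ} (hd : 0 < d) (G : LatticeGas d)
    (ℓ0 : ℕ) (hℓ0 : 0 < ℓ0) (b B : ℝ) (hb : 0 < b) (hB : 0 < B)
    (hSM : SM (gasPotH G) ℓ0 b B)
    (μ : Measure (GConf d)) [IsProbabilityMeasure μ] (hμ : IsGibbs (gasPotH G) μ)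
    (δ : ℝ) (hδ : δ ∈ Set.Ioo (0 : ℝ) (1 / 6 : ℝ)) :
    ∃ c : ℕ, 0 < c ∧ ∃ β : ℝ, 9 ≤ β ∧ ∃ ℓ₁ : ℕ, ∀ ℓ : ℕ, ℓ₁ ≤ ℓ → ℓ0 ∣ ℓ →
      ∃ Mb : Set (ZLat d → ℝ), MeasurableSet Mb ∧ nu μ ℓ Mb = 1 ∧
        (∀ m ∈ Mb,
          Nonempty
            (GentleDisintegration d (goodSet c δ μ ℓ m) (Γex β) (γex β))) ∧
        (∀ (k : ℕ) (t : ZLat d),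
          MeasurableSet[cylR (blocksNear c (Γex β) (γex β) k {t})]
            {m : ZLat d → ℝ |
              t ∈ badSet (Γex β) (γex β) (badInd c δ μ ℓ m) k}) ∧
        (∀ (k : ℕ) (X : Set (ZLat d)), X.Finite → 1 ≤ k →
          MeasurableSet[cylR (blocksNear c (Γex β) (γex β) k X)]
            {m : ZLat d → ℝ |
              X ∈ atomsAt (Γex β) (γex β) (badInd c δ μ ℓ m) k}) := by
  set q : ℝ := Real.exp (-(69 * d)) / 2 with hqdef
  have hq : 0 < q := by positivity
  have hq' : Real.exp (69 * d) * q ≤ 1 / 2 := by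
    rw [hqdef, mul_div_assoc', ← Real.exp_add, add_neg_cancel, Real.exp_zero]
  have hq1 : q ≤ 1 := by
    have : Real.exp (-(69 * d : ℝ)) ≤ 1 := Real.exp_le_one_iff.2 (neg_nonpos.2 (by positivity))
    rw [hqdef]
    linarith
  refine ⟨1, one_pos, 9, le_rfl, ?_⟩
  obtain ⟨ℓ₁, hℓ₁⟩ := Filter.eventually_atTop.1
    (((tendsto_tailBound hd G hb B (B * expSum d b ^ d) hδ.2).eventually_le_const
      (pow_pos hq (3 ^ d))).and (Filter.eventually_ge_atTop 1))
  refine ⟨ℓ₁, fun ℓ hℓ hdvd => ?_⟩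
  obtain ⟨hsmall, hpos⟩ := hℓ₁ ℓ hℓ
  have hT : (0 : ℝ) < (ℓ : ℝ) ^ ((2 / 3 - δ) * d) := Real.rpow_pos_of_pos (by exact_mod_cast hpos) _
  have hae := ae_finite_near_badSet (nu μ ℓ) (fun m => badInd 1 δ μ ℓ m) hq.le hq'
    (nu_forall_badInd_one_le (measure_forall_dev_le hμ hq.le hq1 fun t τ =>
      (gibbsExp_devInd_le hd hℓ0 hb hB hSM hμ hdvd hT t τ).trans hsmall))
  have : IsProbabilityMeasure (nu μ ℓ) :=
    Measure.isProbabilityMeasure_map (measurable_Mblk μ ℓ).aemeasurable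
  rw [ae_iff] at hae
  refine ⟨(toMeasurable (nu μ ℓ) {m | ¬ ∀ x : ZLat d, {k : ℕ | ∃ u ∈ badSet (Γex 9) (γex 9)
      (badInd 1 δ μ ℓ m) k, (supD x u : ℝ) ≤
        theta (Γex 9) (γex 9) (k + 1) + Γex 9 (k + 1)}.Finite})ᶜ,
    (measurableSet_toMeasurable _ _).compl, ?_, fun m hm => ?_, fun k t => ?_, ?_⟩
  · rw [prob_compl_eq_one_iff (measurableSet_toMeasurable _ _), measure_toMeasurable]
    exact hae
  · refine gentleDisintegration_of_horizon (Γex_nonneg 9) Γex_le_γex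
      (badInd_eq_true_iff_notMem 1 δ μ ℓ m) ?_
    by_contra hcon
    exact hm (subset_toMeasurable _ _ hcon)
  · exact @measurableSet_mem_badSet _ (cylR _) _ _ _ (Γex_nonneg 9) (γex_nonneg 9)
      (fun m => badInd 1 δ μ ℓ m) k t fun y hy =>
        measurableSet_badInd_one δ μ ℓ (mem_blocksNear_one rfl hy)
  · rintro (_ | k) X - hk
    · exact absurd hk (by norm_num)
    · exact @measurableSet_mem_atomsAt _ (cylR _) _ _ _ (Γex_nonneg 9) (γex_nonneg 9)
        (fun m => badInd 1 δ μ ℓ m) k X fun x hx y hy =>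
          measurableSet_badInd_one δ μ ℓ (mem_blocksNear_one hx hy)

end

end Paper
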